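/- Let G be a dense, K_4^3 ∪ e-free 3-graph with λ(G) > √3/18. Then G is Y_2-free, where Y_2 is the 3-graph on vertex set {1,...,5} whose edges are the four triples inside {1,2,3,4} and the four triples inside {1,2,3,5} (two copies of K_4^3 sharing the three vertices 1,2,3). -/

import Mathlib

open Finset



/-- An `r`-uniform hypergraph (r-graph) with vertices drawn from `ℕ`. -/
structure HyperGraph (r : ℕ) where
  verts : Finset ℕ
  edges : Finset (Finset ℕ)
  edges_sub : ∀ e ∈ edges, e ⊆ verts
  card_eq : ∀ e ∈ edges, e.card = r

/-- A 3-uniform hypergraph (3-graph). -/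
abbrev ThreeGraph := HyperGraph 3

/-- A feasible weight vector on `G`: nonnegative weights on the vertices summing to 1. -/
def HyperGraph.IsFeasible {r : ℕ} (G : HyperGraph r) (w : ℕ → ℝ) : Prop :=
  (∀ v ∈ G.verts, 0 ≤ w v) ∧ ∑ v ∈ G.verts, w v = 1

/-- The Lagrangian function `λ(G, w) = Σ_{e ∈ E(G)} Π_{v ∈ e} w v`. -/
noncomputable def HyperGraph.lagFun {r : ℕ} (G : HyperGraph r) (w : ℕ → ℝ) : ℝ :=
  ∑ e ∈ G.edges, ∏ v ∈ e, w v

/-- The Lagrangian `λ(G)`: the maximum of `λ(G, w)` over feasible weight vectors. -/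
noncomputable def HyperGraph.lag {r : ℕ} (G : HyperGraph r) : ℝ :=
  sSup {x : ℝ | ∃ w, G.IsFeasible w ∧ G.lagFun w = x}

/-- `G` contains a copy of `F`: an injection of the vertices of `F` into those of `G`
mapping every edge of `F` to an edge of `G`. -/
def HyperGraph.ContainsCopy {r : ℕ} (G F : HyperGraph r) : Prop :=
  ∃ f : ℕ → ℕ, Set.InjOn f ↑F.verts ∧ (∀ v ∈ F.verts, f v ∈ G.verts) ∧
    ∀ e ∈ F.edges, e.image f ∈ G.edges

/-- `G` is `F`-free. -/
def HyperGraph.Free {r : ℕ} (G F : HyperGraph r) : Prop := ¬ G.ContainsCopy F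

/-- `H` is a subgraph of `G`. -/
def HyperGraph.IsSubgraph {r : ℕ} (H G : HyperGraph r) : Prop :=
  H.verts ⊆ G.verts ∧ H.edges ⊆ G.edges

/-- `G` is dense: every proper subgraph has strictly smaller Lagrangian. -/
def HyperGraph.LagDense {r : ℕ} (G : HyperGraph r) : Prop :=
  ∀ H : HyperGraph r, H.IsSubgraph G → (H.verts ≠ G.verts ∨ H.edges ≠ G.edges) →
    H.lag < G.lag

/-- The Lagrangian density `π_λ(F) = sup { r! · λ(G) : G is F-free }`. -/
noncomputable def lagDensity {r : ℕ} (F : HyperGraph r) : ℝ :=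
  sSup {x : ℝ | ∃ G : HyperGraph r, G.Free F ∧ x = (Nat.factorial r : ℝ) * G.lag}

/-- An optimum weight vector for `G`. -/
def HyperGraph.IsOptimal {r : ℕ} (G : HyperGraph r) (w : ℕ → ℝ) : Prop :=
  G.IsFeasible w ∧ G.lagFun w = G.lag

/-- `K_4^3 ∪ e`: the disjoint union of the complete 3-graph on `{1,2,3,4}`
and the single edge `{5,6,7}`. -/
def K43e : ThreeGraph where
  verts := {1, 2, 3, 4, 5, 6, 7}
  edges := {{1, 2, 3}, {1, 2, 4}, {1, 3, 4}, {2, 3, 4}, {5, 6, 7}}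
  edges_sub := by decide
  card_eq := by decide

/-- `Y_2`: two copies of `K_4^3` sharing the three vertices `1, 2, 3`. -/
def Y2 : ThreeGraph where
  verts := {1, 2, 3, 4, 5}
  edges := {{1, 2, 3}, {1, 2, 4}, {1, 3, 4}, {2, 3, 4},
    {1, 2, 5}, {1, 3, 5}, {2, 3, 5}}
  edges_sub := by decide
  card_eq := by decide


set_option maxHeartbeats 4000000 in
theorem PI_M1 (r e b g : ℝ) (hr : 0 ≤ r) (he : 0 ≤ e) (hb : 0 ≤ b) (hg : 0 ≤ g) :
    (r+e)*b*(g+r)+((r+e)+b)*(g^2/3+g*r)+(r+e)*r^2/2+g^3/27+g^2*r/3 ≤ (4811/50000) * (r+(r+e)+b+g)^3 := by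
  linarith [pow_nonneg (show (0:ℝ) ≤ r+(r+e)+b+g by positivity) 3,
    mul_nonneg hr (sq_nonneg ((8)*r + (-7)*b)),
    mul_nonneg he (sq_nonneg ((8)*b + (-3)*g)),
    mul_nonneg hb (sq_nonneg ((1)*r + (4)*e + (8)*b + (-3)*g)),
    mul_nonneg hb (sq_nonneg ((8)*r + (8)*e + (5)*b + (-6)*g)),
    mul_nonneg hg (sq_nonneg ((-1)*r + (-2)*e + (8)*b + (-2)*g)),
    mul_nonneg hg (sq_nonneg ((8)*r + (4)*e + (-1)*b + (-3)*g)),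
    mul_nonneg hr (sq_nonneg ((8)*r + (1)*b + (-4)*g)),
    mul_nonneg hb (sq_nonneg ((-6)*r + (-5)*e + (8)*b + (1)*g)),
    mul_nonneg hr (sq_nonneg ((8)*b + (-3)*g)),
    mul_nonneg hb (sq_nonneg ((8)*r + (-3)*g)),
    mul_nonneg hr (sq_nonneg ((-1)*r + (1)*e + (8)*b + (-2)*g)),
    mul_nonneg he (sq_nonneg ((8)*r + (-1)*b + (-4)*g)),
    mul_nonneg hr (sq_nonneg ((-5)*r + (-8)*e + (2)*b + (3)*g)),
    mul_nonneg hg (sq_nonneg ((8)*r + (-8)*b)),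
    mul_nonneg (mul_nonneg hr hr) he,
    mul_nonneg (mul_nonneg hr he) he,
    mul_nonneg (mul_nonneg he he) he,
    mul_nonneg (mul_nonneg he he) hb,
    mul_nonneg (mul_nonneg he he) hg]

set_option maxHeartbeats 4000000 in
theorem PI_M2 (a k b g : ℝ) (ha : 0 ≤ a) (hk : 0 ≤ k) (hb : 0 ≤ b) (hg : 0 ≤ g) :
    a*b*(g+(a+k))+(a+b)*(g^2/3+g*(a+k))+a*(a+k)^2/2+b*k^2/2+g^3/27+g^2*(a+k)/3 ≤ (4811/50000) * (a+(a+k)+b+g)^3 := by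
  linarith [pow_nonneg (show (0:ℝ) ≤ a+(a+k)+b+g by positivity) 3,
    mul_nonneg hg (sq_nonneg ((-3)*a + (1)*k + (8)*b + (-1)*g)),
    mul_nonneg hg (sq_nonneg ((-2)*a + (-2)*k + (8)*b + (-2)*g)),
    mul_nonneg hb (sq_nonneg ((-8)*a + (6)*b + (2)*g)),
    mul_nonneg ha (sq_nonneg ((8)*a + (-6)*b + (-1)*g)),
    mul_nonneg ha (sq_nonneg ((1)*a + (-4)*k + (8)*b + (-3)*g)),
    mul_nonneg ha (sq_nonneg ((8)*a + (1)*b + (-4)*g)),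
    mul_nonneg hg (sq_nonneg ((4)*a + (8)*k + (3)*b + (-3)*g)),
    mul_nonneg hk (sq_nonneg ((2)*a + (-4)*k + (8)*b + (-3)*g)),
    mul_nonneg hg (sq_nonneg ((8)*a + (2)*k + (-1)*b + (-3)*g)),
    mul_nonneg ha (sq_nonneg ((8)*a + (7)*k + (1)*b + (-3)*g)),
    mul_nonneg hb (sq_nonneg ((8)*a + (3)*k + (4)*b + (-5)*g)),
    mul_nonneg ha (sq_nonneg ((8)*b + (-3)*g)),
    mul_nonneg hg (sq_nonneg ((5)*a + (8)*k + (-4)*g)),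
    mul_nonneg hg (sq_nonneg ((3)*a + (8)*k + (-6)*b + (1)*g)),
    mul_nonneg hg (sq_nonneg ((8)*a + (-8)*b)),
    mul_nonneg hg (sq_nonneg ((2)*a + (-7)*k + (8)*b + (-2)*g)),
    mul_nonneg hb (sq_nonneg ((-8)*a + (-7)*k + (5)*b + (1)*g)),
    mul_nonneg (mul_nonneg ha hk) hk,
    mul_nonneg (mul_nonneg hk hk) hk]

set_option maxHeartbeats 4000000 in
theorem PI_Tb1 (r e b g : ℝ) (hr : 0 ≤ r) (he : 0 ≤ e) (hb : 0 ≤ b) (hg : 0 ≤ g) :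
    (r+e)*b*(g+r)+((r+e)+b)*(2*g^2/5+g*r)+(r+e)*r^2/2+4*g^3/81 ≤ (4811/50000) * (r+(r+e)+b+g)^3 := by
  linarith [pow_nonneg (show (0:ℝ) ≤ r+(r+e)+b+g by positivity) 3,
    mul_nonneg hg (sq_nonneg ((8)*r + (8)*e + (-1)*b + (-5)*g)),
    mul_nonneg hb (sq_nonneg ((8)*r + (8)*e + (-2)*g)),
    mul_nonneg he (sq_nonneg ((8)*b + (-3)*g)),
    mul_nonneg hb (sq_nonneg ((3)*r + (-3)*e + (-8)*b + (2)*g)),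
    mul_nonneg hr (sq_nonneg ((8)*b + (-3)*g)),
    mul_nonneg hg (sq_nonneg ((-1)*r + (-8)*e + (-2)*b + (2)*g)),
    mul_nonneg hg (sq_nonneg ((8)*r + (1)*e + (-6)*b + (1)*g)),
    mul_nonneg he (sq_nonneg ((8)*b + (-1)*g)),
    mul_nonneg hg (sq_nonneg ((8)*e + (8)*b + (-6)*g)),
    mul_nonneg hg (sq_nonneg ((8)*e + (-8)*b)),
    mul_nonneg hr (sq_nonneg ((8)*b + (-5)*g)),
    mul_nonneg (mul_nonneg hr hr) hr,
    mul_nonneg (mul_nonneg hr hr) he,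
    mul_nonneg (mul_nonneg hr hr) hb,
    mul_nonneg (mul_nonneg hr he) he,
    mul_nonneg (mul_nonneg hr he) hg,
    mul_nonneg (mul_nonneg he he) he,
    mul_nonneg (mul_nonneg he he) hb,
    mul_nonneg (mul_nonneg hr hr) hg]

set_option maxHeartbeats 4000000 in
theorem PI_Tb2 (a k b g : ℝ) (ha : 0 ≤ a) (hk : 0 ≤ k) (hb : 0 ≤ b) (hg : 0 ≤ g) :
    a*b*(g+(a+k))+(a+b)*(2*g^2/5+g*(a+k))+a*(a+k)^2/2+b*k^2/2+4*g^3/81 ≤ (4811/50000) * (a+(a+k)+b+g)^3 := by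
  linarith [pow_nonneg (show (0:ℝ) ≤ a+(a+k)+b+g by positivity) 3,
    mul_nonneg hk (sq_nonneg ((-5)*k + (8)*b + (-8)*g)),
    mul_nonneg hg (sq_nonneg ((3)*a + (-8)*k + (8)*b + (-6)*g)),
    mul_nonneg hk (sq_nonneg ((-3)*k + (8)*b)),
    mul_nonneg ha (sq_nonneg ((4)*a + (-8)*b + (3)*g)),
    mul_nonneg ha (sq_nonneg ((8)*a + (4)*b + (-6)*g)),
    mul_nonneg hk (sq_nonneg ((8)*b + (-8)*g)),
    mul_nonneg hg (sq_nonneg ((8)*a + (-8)*b)),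
    mul_nonneg hb (sq_nonneg ((8)*a + (-8)*g)),
    mul_nonneg hb (sq_nonneg ((2)*a + (-3)*k + (8)*b + (-3)*g)),
    mul_nonneg hg (sq_nonneg ((-1)*a + (8)*b + (-3)*g)),
    mul_nonneg hk (sq_nonneg ((8)*k + (-8)*b)),
    mul_nonneg hb (sq_nonneg ((8)*a + (-3)*g)),
    mul_nonneg (mul_nonneg ha ha) hk,
    mul_nonneg (mul_nonneg ha hk) hk,
    mul_nonneg (mul_nonneg ha hk) hb,
    mul_nonneg (mul_nonneg ha hk) hg,
    mul_nonneg (mul_nonneg ha hb) hb,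
    mul_nonneg (mul_nonneg hk hk) hg,
    mul_nonneg (mul_nonneg hk hg) hg]

set_option maxHeartbeats 4000000 in
theorem PI_D1 (r e b c o : ℝ) (hr : 0 ≤ r) (he : 0 ≤ e) (hb : 0 ≤ b) (hc : 0 ≤ c) (ho : 0 ≤ o) :
    (r+e)*b*c+((r+e)*b+(r+e)*c+b*c)*(o+r)+((r+e)+b)*o^2/4+((r+e)+b+c)*o*r+o^2*r/4+(r+e)*r^2/2 ≤ (4811/50000) * ((r+e)+b+c+o+r)^3 := by
  linarith [pow_nonneg (show (0:ℝ) ≤ (r+e)+b+c+o+r by positivity) 3,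
    mul_nonneg hb (sq_nonneg ((-2)*r + (-8)*e + (1)*b + (-7)*c + (6)*o)),
    mul_nonneg hb (sq_nonneg ((-2)*r + (1)*e + (8)*b + (-3)*c + (-3)*o)),
    mul_nonneg he (sq_nonneg ((8)*b + (8)*c + (-6)*o)),
    mul_nonneg ho (sq_nonneg ((8)*e + (-8)*c)),
    mul_nonneg hb (sq_nonneg ((-8)*r + (4)*e + (-1)*b + (4)*o)),
    mul_nonneg hr (sq_nonneg ((8)*r + (-3)*b + (-6)*c + (-2)*o)),
    mul_nonneg hc (sq_nonneg ((8)*r + (4)*e + (8)*b + (8)*c + (-8)*o)),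
    mul_nonneg hr (sq_nonneg ((8)*b + (-8)*c)),
    mul_nonneg ho (sq_nonneg ((5)*r + (8)*e + (-5)*b + (-5)*c + (1)*o)),
    mul_nonneg hr (sq_nonneg ((-6)*r + (1)*e + (8)*c)),
    mul_nonneg hc (sq_nonneg ((8)*r + (-8)*o)),
    mul_nonneg hr (sq_nonneg ((-3)*r + (-6)*e + (-8)*b + (-3)*c + (8)*o)),
    mul_nonneg hb (sq_nonneg ((8)*r + (4)*e + (8)*b + (8)*c + (-8)*o)),
    mul_nonneg hb (sq_nonneg ((8)*e + (-8)*c)),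
    mul_nonneg he (sq_nonneg ((8)*b + (-8)*c)),
    mul_nonneg hr (sq_nonneg ((8)*r + (5)*e + (-5)*b + (6)*c + (-3)*o)),
    mul_nonneg ho (sq_nonneg ((-8)*r + (1)*e + (2)*b + (4)*c + (1)*o)),
    mul_nonneg ho (sq_nonneg ((8)*r + (-8)*b)),
    mul_nonneg he (sq_nonneg ((8)*c + (-8)*o)),
    mul_nonneg hc (sq_nonneg ((8)*r + (-8)*b)),
    mul_nonneg ho (sq_nonneg ((8)*b + (-8)*c)),
    mul_nonneg hc (sq_nonneg ((8)*e + (-8)*b)),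
    mul_nonneg hb (sq_nonneg ((8)*r + (-8)*o)),
    mul_nonneg hc (sq_nonneg ((8)*e + (-8)*o)),
    mul_nonneg ho (sq_nonneg ((-3)*r + (-2)*e + (-3)*b + (-3)*c + (8)*o)),
    mul_nonneg hc (sq_nonneg ((1)*r + (-1)*e + (-8)*b + (-1)*c + (8)*o)),
    mul_nonneg hb (sq_nonneg ((8)*r + (-8)*c)),
    mul_nonneg (mul_nonneg hr hr) he,
    mul_nonneg (mul_nonneg hr he) he,
    mul_nonneg (mul_nonneg hr he) hc,
    mul_nonneg (mul_nonneg he he) he,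
    mul_nonneg (mul_nonneg he he) hb,
    mul_nonneg (mul_nonneg he he) hc,
    mul_nonneg (mul_nonneg hc hc) hc]

set_option maxHeartbeats 4000000 in
theorem PI_D2 (k c d e o : ℝ) (hk : 0 ≤ k) (hc : 0 ≤ c) (hd : 0 ≤ d) (he : 0 ≤ e) (ho : 0 ≤ o) :
    (c+d+e)*(c+d)*c+((c+d+e)*(c+d)+(c+d+e)*c+(c+d)*c)*(o+(c+d+e+k))+((c+d+e)+(c+d))*o^2/4+((c+d+e)+(c+d)+c)*o*(c+d+e+k)+o^2*(c+d+e+k)/4+(c+d+e)*(c+d+e+k)^2/2+((c+d)+c)*k^2/2 ≤ (4811/50000) * ((c+d+e)+(c+d)+c+o+(c+d+e+k))^3 := by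
  linarith [pow_nonneg (show (0:ℝ) ≤ (c+d+e)+(c+d)+c+o+(c+d+e+k) by positivity) 3,
    mul_nonneg hc (sq_nonneg ((4)*k + (8)*c + (8)*d + (4)*e + (-7)*o)),
    mul_nonneg hd (sq_nonneg ((8)*c + (8)*d + (-6)*o)),
    mul_nonneg ho (sq_nonneg ((5)*c + (8)*d + (-6)*o)),
    mul_nonneg hd (sq_nonneg ((-8)*k + (8)*o)),
    mul_nonneg hc (sq_nonneg ((8)*c + (4)*d + (-4)*o)),
    mul_nonneg hc (sq_nonneg ((-3)*k + (8)*c + (-1)*d + (-3)*e)),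
    mul_nonneg ho (sq_nonneg ((5)*k + (-8)*c + (3)*d + (5)*e + (2)*o)),
    mul_nonneg hc (sq_nonneg ((1)*k + (7)*c + (8)*d + (7)*e + (-4)*o)),
    mul_nonneg hc (sq_nonneg ((8)*c + (-8)*o)),
    mul_nonneg ho (sq_nonneg ((1)*k + (1)*c + (1)*d + (8)*e + (-5)*o)),
    mul_nonneg hd (sq_nonneg ((2)*k + (3)*c + (3)*d + (8)*e + (-4)*o)),
    mul_nonneg he (sq_nonneg ((8)*c + (-3)*o)),
    mul_nonneg hd (sq_nonneg ((1)*k + (8)*c + (8)*d + (4)*e + (-3)*o)),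
    mul_nonneg hd (sq_nonneg ((8)*c + (-3)*o)),
    mul_nonneg ho (sq_nonneg ((7)*k + (-8)*c + (-8)*d + (3)*e + (2)*o)),
    mul_nonneg hc (sq_nonneg ((-1)*k + (3)*c + (3)*d + (8)*e + (-4)*o)),
    mul_nonneg hk (sq_nonneg ((4)*k + (-8)*c + (8)*d + (-1)*o)),
    mul_nonneg hk (sq_nonneg ((-6)*k + (8)*c + (8)*d)),
    mul_nonneg ho (sq_nonneg ((8)*k + (-8)*c)),
    mul_nonneg hk (sq_nonneg ((-3)*k + (8)*c + (7)*d + (-1)*o)),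
    mul_nonneg (mul_nonneg hk hk) he,
    mul_nonneg (mul_nonneg he he) ho,
    mul_nonneg (mul_nonneg hk hc) he,
    mul_nonneg (mul_nonneg hk hd) he,
    mul_nonneg (mul_nonneg hk he) he,
    mul_nonneg (mul_nonneg hk he) ho,
    mul_nonneg (mul_nonneg hd he) ho,
    mul_nonneg (mul_nonneg hc hd) hd,
    mul_nonneg (mul_nonneg hc hd) he,
    mul_nonneg (mul_nonneg hc he) he,
    mul_nonneg (mul_nonneg hd hd) hd,
    mul_nonneg (mul_nonneg hd hd) he,
    mul_nonneg (mul_nonneg hd he) he,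
    mul_nonneg (mul_nonneg he he) he]

set_option maxHeartbeats 4000000 in
theorem PI_Ta1 (r e b v o x : ℝ) (hr : 0 ≤ r) (he : 0 ≤ e) (hb : 0 ≤ b) (hv : 0 ≤ v) (ho : 0 ≤ o) (hx : 0 ≤ x) :
    (r+e)*b*(v+o+x+r)+((r+e)+b)*(v*x+v*o+o*x+x^2/4+(v+o+x)*r)+(r+e)*o^2/4+(r+e)*r^2/2+v*x^2/4+v*o*x+o^2*x/4+v*x*r ≤ (4811/50000) * (r+(r+e)+b+v+o+x)^3 := by
  linarith [pow_nonneg (show (0:ℝ) ≤ r+(r+e)+b+v+o+x by positivity) 3,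
    mul_nonneg hv (sq_nonneg ((8)*r + (-8)*x)),
    mul_nonneg ho (sq_nonneg ((8)*r + (-8)*b)),
    mul_nonneg hb (sq_nonneg ((1)*r + (2)*e + (-2)*b + (-6)*v + (-5)*o + (8)*x)),
    mul_nonneg he (sq_nonneg ((8)*b + (-8)*x)),
    mul_nonneg hr (sq_nonneg ((6)*r + (-1)*e + (-1)*b + (-8)*v + (-7)*o + (5)*x)),
    mul_nonneg hv (sq_nonneg ((8)*b + (-8)*o)),
    mul_nonneg hx (sq_nonneg ((-4)*r + (-1)*e + (1)*b + (8)*v + (-6)*o + (1)*x)),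
    mul_nonneg hr (sq_nonneg ((4)*r + (-3)*e + (-1)*b + (-8)*v + (1)*o + (5)*x)),
    mul_nonneg hv (sq_nonneg ((3)*r + (8)*e + (1)*b + (-5)*v + (3)*o + (-4)*x)),
    mul_nonneg ho (sq_nonneg ((8)*v + (-8)*x)),
    mul_nonneg hr (sq_nonneg ((8)*b + (-8)*v)),
    mul_nonneg hr (sq_nonneg ((8)*b + (-8)*o)),
    mul_nonneg he (sq_nonneg ((8)*v + (-8)*x)),
    mul_nonneg hx (sq_nonneg ((-1)*r + (4)*b + (-8)*v + (1)*o + (1)*x)),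
    mul_nonneg hr (sq_nonneg ((8)*b + (-8)*x)),
    mul_nonneg hr (sq_nonneg ((8)*r + (1)*b + (3)*v + (-6)*x)),
    mul_nonneg ho (sq_nonneg ((8)*r + (3)*e + (3)*v + (3)*o + (-7)*x)),
    mul_nonneg hb (sq_nonneg ((7)*r + (7)*e + (-1)*b + (-4)*v + (-8)*o + (1)*x)),
    mul_nonneg hv (sq_nonneg ((1)*r + (-8)*b + (1)*o + (6)*x)),
    mul_nonneg he (sq_nonneg ((8)*r + (-1)*e + (-5)*b + (1)*v + (5)*o + (-3)*x)),
    mul_nonneg he (sq_nonneg ((-8)*b + (-5)*v + (4)*o + (4)*x)),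
    mul_nonneg hb (sq_nonneg ((-2)*r + (-1)*e + (8)*b + (-2)*v + (-1)*o + (-2)*x)),
    mul_nonneg hb (sq_nonneg ((8)*r + (-8)*x)),
    mul_nonneg ho (sq_nonneg ((2)*r + (-8)*e + (-1)*b + (-2)*v + (1)*o + (4)*x)),
    mul_nonneg hr (sq_nonneg ((8)*v + (-8)*x)),
    mul_nonneg he (sq_nonneg ((8)*b + (-8)*v)),
    mul_nonneg hb (sq_nonneg ((3)*r + (1)*e + (-8)*v + (3)*o + (1)*x)),
    mul_nonneg hv (sq_nonneg ((8)*r + (-8)*b)),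
    mul_nonneg hv (sq_nonneg ((8)*e + (-8)*o)),
    mul_nonneg hx (sq_nonneg ((8)*e + (-8)*o)),
    mul_nonneg he (sq_nonneg ((1)*r + (8)*e + (-5)*b + (3)*v + (1)*o + (-3)*x)),
    mul_nonneg hb (sq_nonneg ((8)*v + (-8)*o)),
    mul_nonneg hb (sq_nonneg ((8)*e + (-8)*o)),
    mul_nonneg he (sq_nonneg ((-6)*r + (3)*e + (-6)*b + (-5)*v + (-4)*o + (8)*x)),
    mul_nonneg ho (sq_nonneg ((8)*b + (-8)*v)),
    mul_nonneg hx (sq_nonneg ((8)*r + (3)*e + (-5)*b + (-5)*v + (3)*o + (1)*x)),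
    mul_nonneg ho (sq_nonneg ((8)*b + (-8)*x)),
    mul_nonneg ho (sq_nonneg ((8)*e + (-5)*b + (4)*v + (-7)*o + (2)*x)),
    mul_nonneg hx (sq_nonneg ((3)*r + (8)*e + (-3)*b + (3)*v + (-4)*x)),
    mul_nonneg hx (sq_nonneg ((8)*r + (6)*e + (-2)*b + (-3)*v + (-7)*o + (1)*x)),
    mul_nonneg hx (sq_nonneg ((8)*b + (-8)*v)),
    mul_nonneg hx (sq_nonneg ((8)*e + (-8)*v)),
    mul_nonneg ho (sq_nonneg ((8)*e + (-8)*v)),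
    mul_nonneg hx (sq_nonneg ((-2)*e + (-8)*b + (-2)*v + (2)*o + (7)*x)),
    mul_nonneg ho (sq_nonneg ((1)*r + (-1)*e + (-3)*b + (1)*v + (8)*o + (-4)*x)),
    mul_nonneg hv (sq_nonneg ((2)*r + (-8)*b + (-3)*v + (1)*o + (5)*x)),
    mul_nonneg hv (sq_nonneg ((2)*r + (2)*e + (-5)*b + (8)*v + (4)*o + (-4)*x)),
    mul_nonneg hb (sq_nonneg ((6)*r + (2)*e + (-6)*b + (-2)*v + (8)*o + (-3)*x)),
    mul_nonneg hb (sq_nonneg ((-5)*r + (-8)*e + (-1)*b + (-3)*v + (1)*o + (7)*x)),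
    mul_nonneg he (sq_nonneg ((8)*o + (-8)*x)),
    mul_nonneg hr (sq_nonneg ((4)*r + (8)*e + (-5)*b + (-1)*v + (4)*o + (-2)*x)),
    mul_nonneg hv (sq_nonneg ((8)*r + (2)*e + (-2)*b + (5)*v + (3)*o + (-5)*x)),
    mul_nonneg (mul_nonneg hr hr) he,
    mul_nonneg (mul_nonneg hr he) he,
    mul_nonneg (mul_nonneg he he) he]

set_option maxHeartbeats 4000000 in
theorem PI_Ta2 (a k b v o x : ℝ) (ha : 0 ≤ a) (hk : 0 ≤ k) (hb : 0 ≤ b) (hv : 0 ≤ v) (ho : 0 ≤ o) (hx : 0 ≤ x) :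
    a*b*(v+o+x+(a+k))+(a+b)*(v*x+v*o+o*x+x^2/4+(v+o+x)*(a+k))+a*o^2/4+a*(a+k)^2/2+v*x^2/4+v*o*x+o^2*x/4+v*x*(a+k)+b*k^2/2 ≤ (4811/50000) * (a+(a+k)+b+v+o+x)^3 := by
  linarith [pow_nonneg (show (0:ℝ) ≤ a+(a+k)+b+v+o+x by positivity) 3,
    mul_nonneg hv (sq_nonneg ((8)*b + (-8)*o)),
    mul_nonneg hx (sq_nonneg ((-3)*a + (-2)*k + (-2)*b + (-2)*v + (-2)*o + (8)*x)),
    mul_nonneg hk (sq_nonneg ((7)*k + (-8)*b + (6)*v + (7)*o + (6)*x)),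
    mul_nonneg hb (sq_nonneg ((8)*v + (-8)*x)),
    mul_nonneg ho (sq_nonneg ((8)*b + (8)*v + (-6)*x)),
    mul_nonneg hb (sq_nonneg ((8)*a + (-8)*o)),
    mul_nonneg hk (sq_nonneg ((-1)*a + (-3)*k + (8)*b + (-1)*v + (1)*x)),
    mul_nonneg ha (sq_nonneg ((1)*a + (5)*k + (8)*b + (-5)*v + (-8)*o + (-2)*x)),
    mul_nonneg hb (sq_nonneg ((-8)*a + (-1)*k + (1)*v + (7)*x)),
    mul_nonneg ha (sq_nonneg ((8)*b + (-8)*v)),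
    mul_nonneg ha (sq_nonneg ((8)*b + (-8)*o)),
    mul_nonneg hk (sq_nonneg ((8)*a + (-1)*k + (2)*b + (1)*v + (-7)*x)),
    mul_nonneg ho (sq_nonneg ((7)*a + (7)*k + (-8)*b + (7)*v + (2)*o + (2)*x)),
    mul_nonneg ha (sq_nonneg ((8)*b + (-8)*x)),
    mul_nonneg hv (sq_nonneg ((-5)*a + (8)*k + (-1)*b + (-5)*v + (-5)*o + (8)*x)),
    mul_nonneg hb (sq_nonneg ((-3)*a + (-3)*k + (8)*b + (-2)*v + (-2)*o + (-2)*x)),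
    mul_nonneg hk (sq_nonneg ((8)*b + (-8)*v)),
    mul_nonneg hv (sq_nonneg ((8)*b + (-8)*x)),
    mul_nonneg hb (sq_nonneg ((-2)*a + (1)*b + (8)*v + (4)*o + (-3)*x)),
    mul_nonneg ha (sq_nonneg ((8)*a + (1)*k + (-2)*b + (-2)*v + (2)*o + (-3)*x)),
    mul_nonneg hk (sq_nonneg ((8)*k + (-8)*b)),
    mul_nonneg hx (sq_nonneg ((8)*b + (-8)*v)),
    mul_nonneg ho (sq_nonneg ((8)*k + (-8)*b)),
    mul_nonneg hk (sq_nonneg ((8)*b + (-8)*o)),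
    mul_nonneg ho (sq_nonneg ((8)*a + (1)*v + (1)*o + (-7)*x)),
    mul_nonneg hk (sq_nonneg ((8)*b + (-8)*x)),
    mul_nonneg hx (sq_nonneg ((8)*a + (-8)*v)),
    mul_nonneg hv (sq_nonneg ((-3)*a + (-2)*k + (8)*b + (8)*v + (-4)*x)),
    mul_nonneg ho (sq_nonneg ((8)*a + (-8)*b)),
    mul_nonneg ha (sq_nonneg ((-8)*a + (-8)*v + (8)*o + (8)*x)),
    mul_nonneg ho (sq_nonneg ((8)*b + (-8)*v)),
    mul_nonneg hk (sq_nonneg ((8)*v + (-8)*x)),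
    mul_nonneg hb (sq_nonneg ((8)*v + (-8)*o)),
    mul_nonneg hv (sq_nonneg ((-1)*a + (-6)*k + (-8)*b + (7)*v + (3)*o + (2)*x)),
    mul_nonneg hx (sq_nonneg ((8)*a + (-8)*b)),
    mul_nonneg hv (sq_nonneg ((-4)*a + (-8)*k + (2)*b + (-3)*v + (-8)*o + (5)*x)),
    mul_nonneg ha (sq_nonneg ((-1)*a + (7)*k + (3)*b + (8)*v + (5)*o + (-7)*x)),
    mul_nonneg ho (sq_nonneg ((8)*v + (-8)*x)),
    mul_nonneg ho (sq_nonneg ((-8)*o + (8)*x)),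
    mul_nonneg ho (sq_nonneg ((2)*a + (-2)*b + (2)*v + (-8)*o + (1)*x)),
    mul_nonneg ho (sq_nonneg ((8)*b + (-8)*x)),
    mul_nonneg hx (sq_nonneg ((6)*a + (8)*k + (-7)*b + (-7)*v + (8)*o + (3)*x)),
    mul_nonneg hb (sq_nonneg ((1)*a + (-7)*b + (-2)*v + (8)*o + (1)*x)),
    mul_nonneg (mul_nonneg ha ha) hk,
    mul_nonneg (mul_nonneg ha hk) ho,
    mul_nonneg (mul_nonneg hk hx) hx,
    mul_nonneg (mul_nonneg hk hk) ho,
    mul_nonneg (mul_nonneg ha hk) hv,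
    mul_nonneg (mul_nonneg hk hv) ho,
    mul_nonneg (mul_nonneg hk ho) ho,
    mul_nonneg (mul_nonneg hk ho) hx,
    mul_nonneg (mul_nonneg ha hk) hx,
    mul_nonneg (mul_nonneg hv ho) ho,
    mul_nonneg (mul_nonneg ho ho) ho,
    mul_nonneg (mul_nonneg ha ho) ho]

theorem PI_M {a b g r : ℝ} (ha : 0 ≤ a) (hb : 0 ≤ b) (hg : 0 ≤ g) (hr : 0 ≤ r)
    (hs : a + b + g + r = 1) :
    a*b*(g+r)+(a+b)*(g^2/3+g*r)+a*r^2/2+b*(max (r-a) 0)^2/2+g^3/27+g^2*r/3 ≤ 4811/50000 := by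
  rcases le_total r a with h | h
  · obtain ⟨e, rfl⟩ : ∃ e, a = r + e := ⟨a - r, by ring⟩
    have := PI_M1 r e b g hr (by linarith) hb hg
    rw [show r + (r+e) + b + g = 1 by linarith] at this
    rw [max_eq_right (by linarith)]; linarith
  · obtain ⟨k, rfl⟩ : ∃ k, r = a + k := ⟨r - a, by ring⟩
    have := PI_M2 a k b g ha (by linarith) hb hg
    rw [show a + (a+k) + b + g = 1 by linarith] at this
    rw [max_eq_left (by linarith)]; linarith

theorem PI_Tb {a b g r : ℝ} (ha : 0 ≤ a) (hb : 0 ≤ b) (hg : 0 ≤ g) (hr : 0 ≤ r)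
    (hs : a + b + g + r = 1) :
    a*b*(g+r)+(a+b)*(2*g^2/5+g*r)+a*r^2/2+b*(max (r-a) 0)^2/2+4*g^3/81 ≤ 4811/50000 := by
  rcases le_total r a with h | h
  · obtain ⟨e, rfl⟩ : ∃ e, a = r + e := ⟨a - r, by ring⟩
    have := PI_Tb1 r e b g hr (by linarith) hb hg
    rw [show r + (r+e) + b + g = 1 by linarith] at this
    rw [max_eq_right (by linarith)]; linarith
  · obtain ⟨k, rfl⟩ : ∃ k, r = a + k := ⟨r - a, by ring⟩
    have := PI_Tb2 a k b g ha (by linarith) hb hg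
    rw [show a + (a+k) + b + g = 1 by linarith] at this
    rw [max_eq_left (by linarith)]; linarith

theorem PI_Ta {a b v o x r : ℝ} (ha : 0 ≤ a) (hb : 0 ≤ b) (hv : 0 ≤ v) (ho : 0 ≤ o) (hx : 0 ≤ x)
    (hr : 0 ≤ r) (hs : a + b + v + o + x + r = 1) :
    a*b*(v+o+x+r)+(a+b)*(v*x+v*o+o*x+x^2/4+(v+o+x)*r)+a*o^2/4+a*r^2/2+v*x^2/4+v*o*x+o^2*x/4+v*x*r
      +b*(max (r-a) 0)^2/2 ≤ 4811/50000 := by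
  rcases le_total r a with h | h
  · obtain ⟨e, rfl⟩ : ∃ e, a = r + e := ⟨a - r, by ring⟩
    have := PI_Ta1 r e b v o x hr (by linarith) hb hv ho hx
    rw [show r + (r+e) + b + v + o + x = 1 by linarith] at this
    rw [max_eq_right (by linarith)]; linarith
  · obtain ⟨k, rfl⟩ : ∃ k, r = a + k := ⟨r - a, by ring⟩
    have := PI_Ta2 a k b v o x ha (by linarith) hb hv ho hx
    rw [show a + (a+k) + b + v + o + x = 1 by linarith] at this
    rw [max_eq_left (by linarith)]; linarith

theorem PI_D {a b c o r : ℝ} (hba : b ≤ a) (hcb : c ≤ b) (hc : 0 ≤ c) (ho : 0 ≤ o)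
    (hr : 0 ≤ r) (hs : a + b + c + o + r = 1) :
    a*b*c+(a*b+a*c+b*c)*(o+r)+(a+b)*o^2/4+(a+b+c)*o*r+o^2*r/4+a*r^2/2
      +(b+c)*(max (r-a) 0)^2/2 ≤ 4811/50000 := by
  rcases le_total r a with h | h
  · obtain ⟨e, rfl⟩ : ∃ e, a = r + e := ⟨a - r, by ring⟩
    have := PI_D1 r e b c o hr (by linarith) (by linarith) hc ho
    rw [show (r+e) + b + c + o + r = 1 by linarith] at this
    rw [max_eq_right (by linarith)]; linarith
  · obtain ⟨d, rfl⟩ : ∃ d, b = c + d := ⟨b - c, by ring⟩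
    obtain ⟨e, rfl⟩ : ∃ e, a = c + d + e := ⟨a - (c + d), by ring⟩
    obtain ⟨k, rfl⟩ : ∃ k, r = c + d + e + k := ⟨r - (c + d + e), by ring⟩
    have := PI_D2 k c d e o (by linarith) hc (by linarith) (by linarith) ho
    rw [show (c+d+e)+(c+d)+c+o+(c+d+e+k) = 1 by linarith] at this
    rw [max_eq_left (by linarith)]; linarith

/-- The baseline inequality. -/
theorem PI_S {a b y : ℝ} (ha : 0 ≤ a) (hb : 0 ≤ b) (hy : 0 ≤ y) (hs : a + b + y = 1) :
    6 * (a * b * y + (a + b) * y ^ 2 / 2) ≤ Real.sqrt 3 / 3 := by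
  have h3 : Real.sqrt 3 ^ 2 = 3 := Real.sq_sqrt (by norm_num)
  have h0 := Real.sqrt_nonneg 3
  set q := Real.sqrt 3
  have e : a + b = 1 - y := by linarith
  have h1 : a * b ≤ (1 - y) ^ 2 / 4 := by rw [← e]; nlinarith [sq_nonneg (a - b)]
  have h2 : a * b * y ≤ (1 - y) ^ 2 / 4 * y := mul_le_mul_of_nonneg_right h1 hy
  rw [e]
  have h4 : 0 ≤ (q * y - 1) ^ 2 * (q * y + 2) := by positivity
  have h5 : (q * y - 1) ^ 2 * (q * y + 2) = q ^ 2 * q * y ^ 3 - 3 * q * y + 2 := by ring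
  rw [h5, h3] at h4
  have h6 := mul_nonneg h0 h4
  have h7 : q * (3 * q * y ^ 3 - 3 * q * y + 2) = q^2 * (3 * y ^ 3 - 3 * y) + 2 * q := by ring
  rw [h7, h3] at h6
  nlinarith

theorem c_lt : 6 * (4811 / 50000 : ℝ) < Real.sqrt 3 / 3 := by
  have : (1.732 : ℝ) < Real.sqrt 3 := Real.lt_sqrt_of_sq_lt (by norm_num)
  norm_num at *; linarith

/-- Bundled local data: symmetric 3-graph relation, weights, and the consequence of being
`K_4^3 ∪ e`-free that every edge meets every `K_4^3`. -/
structure Ctx where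
  V : Finset ℕ
  E : ℕ → ℕ → ℕ → Prop
  w : ℕ → ℝ
  s1 : ∀ {a b c}, E a b c → E b a c
  s2 : ∀ {a b c}, E a b c → E a c b
  ne : ∀ {a b c}, E a b c → a ≠ b
  mem : ∀ {a b c}, E a b c → a ∈ V
  K : ∀ {a b c d x y z}, E a b c → E a b d → E a c d → E b c d → E x y z →
    (x = a ∨ x = b ∨ x = c ∨ x = d) ∨ (y = a ∨ y = b ∨ y = c ∨ y = d) ∨
      (z = a ∨ z = b ∨ z = c ∨ z = d)
  nn : ∀ v, 0 ≤ w v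

namespace Ctx

open Classical in
noncomputable def chi (C : Ctx) (a b c : ℕ) : ℝ := if C.E a b c then 1 else 0

noncomputable def psi (C : Ctx) (a b c : ℕ) : ℝ := C.chi a b c * (C.w a * C.w b * C.w c)

noncomputable def W (C : Ctx) (S : Finset ℕ) : ℝ := ∑ x ∈ S, C.w x
noncomputable def T1 (C : Ctx) (a b : ℕ) (S : Finset ℕ) : ℝ := ∑ z ∈ S, C.psi a b z
noncomputable def T2 (C : Ctx) (a : ℕ) (S : Finset ℕ) : ℝ := ∑ y ∈ S, ∑ z ∈ S, C.psi a y z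
noncomputable def T3 (C : Ctx) (S : Finset ℕ) : ℝ :=
  ∑ x ∈ S, ∑ y ∈ S, ∑ z ∈ S, C.psi x y z

variable (C : Ctx)

theorem s3 {a b c : ℕ} (h : C.E a b c) : C.E c b a := C.s1 (C.s2 (C.s1 h))
theorem r1 {a b c : ℕ} (h : C.E a b c) : C.E b c a := C.s2 (C.s1 h)
theorem r2 {a b c : ℕ} (h : C.E a b c) : C.E c a b := C.s1 (C.s2 h)
theorem ne2 {a b c : ℕ} (h : C.E a b c) : a ≠ c := C.ne (C.s2 h)
theorem ne3 {a b c : ℕ} (h : C.E a b c) : b ≠ c := C.ne (C.r1 h)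
theorem mem2 {a b c : ℕ} (h : C.E a b c) : b ∈ C.V := C.mem (C.s1 h)
theorem mem3 {a b c : ℕ} (h : C.E a b c) : c ∈ C.V := C.mem (C.r2 h)

theorem chi_one {a b c : ℕ} (h : C.E a b c) : C.chi a b c = 1 := by simp [chi, h]
theorem chi_zero {a b c : ℕ} (h : ¬ C.E a b c) : C.chi a b c = 0 := by simp [chi, h]
theorem chi_nonneg (a b c : ℕ) : 0 ≤ C.chi a b c := by unfold chi; split_ifs <;> norm_num
theorem chi_le (a b c : ℕ) : C.chi a b c ≤ 1 := by unfold chi; split_ifs <;> norm_num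
theorem chi_s1 (a b c : ℕ) : C.chi a b c = C.chi b a c := by
  by_cases h : C.E a b c
  · rw [C.chi_one h, C.chi_one (C.s1 h)]
  · rw [C.chi_zero h, C.chi_zero fun h' => h (C.s1 h')]
theorem chi_s2 (a b c : ℕ) : C.chi a b c = C.chi a c b := by
  by_cases h : C.E a b c
  · rw [C.chi_one h, C.chi_one (C.s2 h)]
  · rw [C.chi_zero h, C.chi_zero fun h' => h (C.s2 h')]
theorem psi_s1 (a b c : ℕ) : C.psi a b c = C.psi b a c := by
  unfold psi; rw [chi_s1]; ring
theorem psi_s2 (a b c : ℕ) : C.psi a b c = C.psi a c b := by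
  unfold psi; rw [chi_s2]; ring
theorem psi_zero {a b c : ℕ} (h : ¬ C.E a b c) : C.psi a b c = 0 := by
  simp [psi, C.chi_zero h]
theorem psi_self (a b : ℕ) : C.psi a a b = 0 := C.psi_zero fun h => C.ne h rfl
theorem psi_self2 (a b : ℕ) : C.psi a b b = 0 := C.psi_zero fun h => C.ne3 h rfl
theorem www (a b c : ℕ) : 0 ≤ C.w a * C.w b * C.w c :=
  mul_nonneg (mul_nonneg (C.nn a) (C.nn b)) (C.nn c)
theorem psi_nonneg (a b c : ℕ) : 0 ≤ C.psi a b c :=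
  mul_nonneg (C.chi_nonneg a b c) (C.www a b c)
theorem psi_le (a b c : ℕ) : C.psi a b c ≤ C.w a * C.w b * C.w c :=
  mul_le_of_le_one_left (C.www a b c) (C.chi_le a b c)
theorem W_nonneg (S : Finset ℕ) : 0 ≤ C.W S := Finset.sum_nonneg fun _ _ => C.nn _

theorem W_insert {c : ℕ} {S : Finset ℕ} (h : c ∉ S) : C.W (insert c S) = C.w c + C.W S := by
  simp [W, Finset.sum_insert h]
theorem T1_insert (a b : ℕ) {c : ℕ} {S : Finset ℕ} (h : c ∉ S) :
    C.T1 a b (insert c S) = C.psi a b c + C.T1 a b S := by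
  simp [T1, Finset.sum_insert h]
theorem T2_insert (a : ℕ) {b : ℕ} {S : Finset ℕ} (h : b ∉ S) :
    C.T2 a (insert b S) = 2 * C.T1 a b S + C.T2 a S := by
  simp only [T2, T1, Finset.sum_insert h, Finset.sum_add_distrib, psi_self2]
  have : ∑ x ∈ S, C.psi a x b = ∑ x ∈ S, C.psi a b x :=
    Finset.sum_congr rfl fun x _ => C.psi_s2 _ _ _
  rw [this]; ring
theorem T3_insert {a : ℕ} {S : Finset ℕ} (h : a ∉ S) :
    C.T3 (insert a S) = 3 * C.T2 a S + C.T3 S := by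
  simp only [T3, T2, Finset.sum_insert h, Finset.sum_add_distrib, psi_self2, psi_self]
  have h0 : ∑ x ∈ S, C.psi a x a = 0 := Finset.sum_eq_zero fun x _ => by
    rw [psi_s2, psi_self]
  have h1 : ∑ x ∈ S, ∑ y ∈ S, C.psi x a y = ∑ x ∈ S, ∑ y ∈ S, C.psi a x y :=
    Finset.sum_congr rfl fun x _ => Finset.sum_congr rfl fun y _ => C.psi_s1 _ _ _
  have h2 : ∑ x ∈ S, ∑ y ∈ S, C.psi x y a = ∑ x ∈ S, ∑ y ∈ S, C.psi a x y :=
    Finset.sum_congr rfl fun x _ => Finset.sum_congr rfl fun y _ => by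
      rw [psi_s2, psi_s1]
  simp only [Finset.sum_const_zero, h0, h1, h2]; ring
theorem T1_empty (a b : ℕ) : C.T1 a b ∅ = 0 := by simp [T1]
theorem T2_empty (a : ℕ) : C.T2 a ∅ = 0 := by simp [T2]
theorem T3_empty : C.T3 ∅ = 0 := by simp [T3]
theorem W_empty : C.W ∅ = 0 := by simp [W]

theorem T1_le (a b : ℕ) (S : Finset ℕ) : C.T1 a b S ≤ C.w a * C.w b * C.W S := by
  unfold T1 W
  rw [Finset.mul_sum]
  exact Finset.sum_le_sum fun x _ => C.psi_le _ _ _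
theorem T1_zero {a b : ℕ} {S : Finset ℕ} (h : ∀ z ∈ S, ¬ C.E a b z) : C.T1 a b S = 0 :=
  Finset.sum_eq_zero fun x hx => C.psi_zero (h x hx)
theorem T2_zero {a : ℕ} {S : Finset ℕ} (h : ∀ y ∈ S, ∀ z ∈ S, ¬ C.E a y z) : C.T2 a S = 0 :=
  Finset.sum_eq_zero fun y hy => Finset.sum_eq_zero fun x hx => C.psi_zero (h y hy x hx)
theorem T3_zero {S : Finset ℕ} (h : ∀ x ∈ S, ∀ y ∈ S, ∀ z ∈ S, ¬ C.E x y z) : C.T3 S = 0 :=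
  Finset.sum_eq_zero fun x hx => Finset.sum_eq_zero fun y hy =>
    Finset.sum_eq_zero fun z hz => C.psi_zero (h x hx y hy z hz)

theorem T1_union (a b : ℕ) {O R : Finset ℕ} (h : Disjoint O R) :
    C.T1 a b (O ∪ R) = C.T1 a b O + C.T1 a b R := Finset.sum_union h
theorem T2_union_le (a : ℕ) {O R : Finset ℕ} (h : Disjoint O R) :
    C.T2 a (O ∪ R) ≤ C.T2 a O + 2 * (C.w a * C.W O * C.W R) + C.T2 a R := by
  simp only [T2, Finset.sum_union h, Finset.sum_add_distrib]
  have h1 : ∑ x ∈ O, ∑ y ∈ R, C.psi a x y ≤ C.w a * C.W O * C.W R := by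
    unfold W
    rw [mul_assoc, Finset.sum_mul_sum, Finset.mul_sum]
    refine Finset.sum_le_sum fun x _ => ?_
    rw [Finset.mul_sum]
    exact Finset.sum_le_sum fun y _ => by have := C.psi_le a x y; linarith
  have h2 : ∑ x ∈ R, ∑ y ∈ O, C.psi a x y = ∑ x ∈ O, ∑ y ∈ R, C.psi a x y := by
    rw [Finset.sum_comm]
    exact Finset.sum_congr rfl fun x _ => Finset.sum_congr rfl fun y _ => C.psi_s2 _ _ _
  linarith

theorem dsum (R : Finset ℕ) (m : ℕ → ℝ) :
    ∑ x ∈ R, ∑ y ∈ R, C.w x * C.w y * (1 - (1 - m x) * (1 - m y)) =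
      (C.W R) ^ 2 - (C.W R - ∑ x ∈ R, C.w x * m x) ^ 2 := by
  have e : C.W R - ∑ x ∈ R, C.w x * m x = ∑ x ∈ R, C.w x * (1 - m x) := by
    unfold W; rw [← Finset.sum_sub_distrib]
    exact Finset.sum_congr rfl fun x _ => by ring
  rw [e]; unfold W
  rw [sq, sq, Finset.sum_mul_sum, Finset.sum_mul_sum, ← Finset.sum_sub_distrib]
  refine Finset.sum_congr rfl fun x _ => ?_
  rw [← Finset.sum_sub_distrib]
  exact Finset.sum_congr rfl fun y _ => by ring

theorem dsum1 (R : Finset ℕ) :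
    ∑ x ∈ R, ∑ y ∈ R, C.w x * C.w y = (C.W R) ^ 2 := by
  unfold W; rw [sq, Finset.sum_mul_sum]

theorem kappa_aux {m r a : ℝ} (hm : 0 ≤ m) :
    2 * m * (r - a) - m ^ 2 ≤ (max (r - a) 0) ^ 2 := by
  nlinarith [le_max_left (r - a) 0, le_max_right (r - a) 0, sq_nonneg (m - max (r - a) 0),
    mul_le_mul_of_nonneg_left (le_max_left (r - a) 0) hm]

/-- The pair lemma. -/
theorem pair_lemma {a b : ℕ} {O R : Finset ℕ} (hab : a ≠ b) (ha : a ∉ O ∪ R) (hb : b ∉ O ∪ R)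
    (hV : C.V = insert a (insert b (O ∪ R))) (hOR : Disjoint O R) (hw : C.w b ≤ C.w a)
    (hR : ∀ x ∈ R, ∀ y ∈ R, C.E a b x → C.E a b y → C.E a x y → C.E b x y → False) :
    C.T3 C.V ≤ 6 * (C.w a * C.w b * (C.W O + C.W R)) + 3 * (C.T2 a O + C.T2 b O)
      + 6 * ((C.w a + C.w b) * C.W O * C.W R) + 3 * (C.w a * C.W R ^ 2)
      + 3 * (C.w b * (max (C.W R - C.w a) 0) ^ 2) + C.T3 (O ∪ R) := by
  rw [hV, T3_insert _ (by simp only [Finset.mem_insert, not_or]; exact ⟨hab, ha⟩), T2_insert _ _ hb, T3_insert _ hb,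
    T1_union _ _ _ hOR]
  have h1 := C.T2_union_le a hOR
  have h2 := C.T2_union_le b hOR
  have h3 := C.T1_le a b O
  set m : ℕ → ℝ := fun x => 1 - C.chi a b x with hm
  set M := ∑ x ∈ R, C.w x * m x with hM
  have hM0 : 0 ≤ M := Finset.sum_nonneg fun x _ =>
    mul_nonneg (C.nn x) (by simp only [hm]; linarith [C.chi_le a b x])
  have h4 : C.T1 a b R = C.w a * C.w b * (C.W R - M) := by
    unfold T1 W; rw [hM, ← Finset.sum_sub_distrib, Finset.mul_sum]
    refine Finset.sum_congr rfl fun x _ => ?_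
    simp only [hm, psi]; ring
  have h5 : C.T2 a R + C.T2 b R ≤ C.w a * C.W R ^ 2 + C.w b * (C.W R ^ 2 - (C.W R - M) ^ 2) := by
    rw [hM, ← C.dsum R m, ← C.dsum1, Finset.mul_sum, Finset.mul_sum]
    unfold T2
    rw [← Finset.sum_add_distrib, ← Finset.sum_add_distrib]
    refine Finset.sum_le_sum fun x hx => ?_
    rw [Finset.mul_sum, Finset.mul_sum]
    rw [← Finset.sum_add_distrib, ← Finset.sum_add_distrib]
    refine Finset.sum_le_sum fun y hy => ?_
    have hxy := mul_nonneg (C.nn x) (C.nn y)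
    have key : C.chi a x y * C.w a + C.chi b x y * C.w b ≤
        C.w a + C.w b * (1 - C.chi a b x * C.chi a b y) := by
      have := C.nn a
      have := C.nn b
      by_cases p : C.E a x y <;> by_cases q : C.E b x y <;> by_cases u : C.E a b x <;>
        by_cases v : C.E a b y <;>
        first
        | exact (hR x hx y hy u v p q).elim
        | (simp only [chi, p, q, u, v, if_true, if_false]; linarith)
    have := mul_le_mul_of_nonneg_right key hxy
    simp only [psi, hm]
    linarith
  have h6 := mul_le_mul_of_nonneg_left (kappa_aux (r := C.W R) (a := C.w a) hM0) (C.nn b)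
  rw [h4]
  nlinarith

end Ctx

namespace Ctx

variable (C : Ctx)

theorem T2_expand3 (z : ℕ) {a b c : ℕ} {R : Finset ℕ} (hab : a ≠ b) (hac : a ≠ c) (hbc : b ≠ c)
    (ha : a ∉ R) (hb : b ∉ R) (hc : c ∉ R) :
    C.T2 z (insert a (insert b (insert c R))) =
      2 * (C.psi z a b + C.psi z a c + C.psi z b c)
      + 2 * (C.T1 z a R + C.T1 z b R + C.T1 z c R) + C.T2 z R := by
  have h1 : a ∉ insert b (insert c R) := by simp [*]
  have h2 : b ∉ insert c R := by simp [*]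
  simp only [T2_insert _ _ h1, T2_insert _ _ h2, T2_insert _ _ hc,
    T1_insert _ _ _ h2, T1_insert _ _ _ hc]
  ring

theorem T3_expand3 {a b c : ℕ} {R : Finset ℕ} (hab : a ≠ b) (hac : a ≠ c) (hbc : b ≠ c)
    (ha : a ∉ R) (hb : b ∉ R) (hc : c ∉ R) :
    C.T3 (insert a (insert b (insert c R))) =
      6 * C.psi a b c
      + 6 * (C.T1 a b R + C.T1 a c R + C.T1 b c R)
      + 3 * (C.T2 a R + C.T2 b R + C.T2 c R) + C.T3 R := by
  have h1 : a ∉ insert b (insert c R) := by simp [*]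
  have h2 : b ∉ insert c R := by simp [*]
  simp only [T3_insert _ h1, T3_insert _ h2, T3_insert _ hc, T2_insert _ _ h2, T2_insert _ _ hc,
    T1_insert _ _ _ hc]
  ring

theorem T2_expand5 (z : ℕ) {a b c d e : ℕ} {R : Finset ℕ} (hab : a ≠ b) (hac : a ≠ c)
    (had : a ≠ d) (hae : a ≠ e) (hbc : b ≠ c) (hbd : b ≠ d) (hbe : b ≠ e) (hcd : c ≠ d)
    (hce : c ≠ e) (hde : d ≠ e)
    (ha : a ∉ R) (hb : b ∉ R) (hc : c ∉ R) (hd : d ∉ R) (he : e ∉ R) :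
    C.T2 z (insert a (insert b (insert c (insert d (insert e R))))) =
      2 * (C.psi z a b + C.psi z a c + C.psi z b c + C.psi z a d + C.psi z b d + C.psi z c d
        + C.psi z a e + C.psi z b e + C.psi z c e + C.psi z d e)
      + 2 * (C.T1 z a R + C.T1 z b R + C.T1 z c R + C.T1 z d R + C.T1 z e R) + C.T2 z R := by
  have h1 : d ∉ insert e R := by simp [*]
  rw [C.T2_expand3 z hab hac hbc (by simp [*]) (by simp [*]) (by simp [*])]
  simp only [T2_insert _ _ h1, T2_insert _ _ he, T1_insert _ _ _ h1, T1_insert _ _ _ he]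
  ring

theorem T3_expand5 {a b c d e : ℕ} {R : Finset ℕ} (hab : a ≠ b) (hac : a ≠ c)
    (had : a ≠ d) (hae : a ≠ e) (hbc : b ≠ c) (hbd : b ≠ d) (hbe : b ≠ e) (hcd : c ≠ d)
    (hce : c ≠ e) (hde : d ≠ e)
    (ha : a ∉ R) (hb : b ∉ R) (hc : c ∉ R) (hd : d ∉ R) (he : e ∉ R) :
    C.T3 (insert a (insert b (insert c (insert d (insert e R))))) =
      6 * (C.psi a b c + C.psi a b d + C.psi a c d + C.psi b c d + C.psi a b e + C.psi a c e
        + C.psi b c e + C.psi a d e + C.psi b d e + C.psi c d e)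
      + 6 * (C.T1 a b R + C.T1 a c R + C.T1 b c R + C.T1 a d R + C.T1 b d R + C.T1 c d R
        + C.T1 a e R + C.T1 b e R + C.T1 c e R + C.T1 d e R)
      + 3 * (C.T2 a R + C.T2 b R + C.T2 c R + C.T2 d R + C.T2 e R) + C.T3 R := by
  have h1 : d ∉ insert e R := by simp [*]
  rw [C.T3_expand3 hab hac hbc (by simp [*]) (by simp [*]) (by simp [*])]
  simp only [T3_insert _ h1, T3_insert _ he, T2_insert _ _ h1, T2_insert _ _ he,
    T1_insert _ _ _ h1, T1_insert _ _ _ he]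
  ring

theorem W_pair {a b : ℕ} {O R : Finset ℕ} (hab : a ≠ b) (ha : a ∉ O ∪ R) (hb : b ∉ O ∪ R)
    (hV : C.V = insert a (insert b (O ∪ R))) (hOR : Disjoint O R) :
    C.w a + C.w b + C.W O + C.W R = C.W C.V := by
  rw [hV, C.W_insert (by simp only [Finset.mem_insert, not_or]; exact ⟨hab, ha⟩),
    C.W_insert hb]
  have : C.W (O ∪ R) = C.W O + C.W R := Finset.sum_union hOR
  rw [this]; ring

theorem lemM_aux {a b h1 h2 h3 : ℕ} (hs : C.W C.V = 1) (hab : a ≠ b) (ha : a ∈ C.V) (hb : b ∈ C.V)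
    (hE : C.E h1 h2 h3) (a1 : h1 ≠ a) (a2 : h2 ≠ a) (a3 : h3 ≠ a)
    (b1 : h1 ≠ b) (b2 : h2 ≠ b) (b3 : h3 ≠ b) (hw : C.w b ≤ C.w a)
    (hH : ∀ x y z, C.E x y z → x ≠ a → x ≠ b → x ≠ h1 → x ≠ h2 → x ≠ h3 →
      y ≠ a → y ≠ b → y ≠ h1 → y ≠ h2 → y ≠ h3 → z = a ∨ z = b) :
    C.T3 C.V ≤ 6 * (4811 / 50000) := by
  have n12 := C.ne hE
  have n13 := C.ne2 hE
  have n23 := C.ne3 hE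
  have m1 := C.mem hE
  have m2 := C.mem2 hE
  have m3 := C.mem3 hE
  set R := C.V \ {a, b, h1, h2, h3} with hRdef
  have hR : ∀ x, x ∈ R ↔ x ∈ C.V ∧ x ≠ a ∧ x ≠ b ∧ x ≠ h1 ∧ x ≠ h2 ∧ x ≠ h3 := by
    intro x; simp [hRdef]
  set O : Finset ℕ := insert h1 (insert h2 (insert h3 ∅)) with hO
  have hV : C.V = insert a (insert b (O ∪ R)) := by
    ext x; simp only [hO, Finset.mem_insert, Finset.mem_union, hR, Finset.notMem_empty]
    grind
  have hdis : Disjoint O R := by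
    rw [Finset.disjoint_left]; intro x; simp only [hO, Finset.mem_insert, hR, Finset.notMem_empty]
    grind
  have haO : a ∉ O ∪ R := by
    simp only [hO, Finset.mem_insert, Finset.mem_union, hR, Finset.notMem_empty]; grind
  have hbO : b ∉ O ∪ R := by
    simp only [hO, Finset.mem_insert, Finset.mem_union, hR, Finset.notMem_empty]; grind
  have i1 : h1 ∉ R := by simp [hR]
  have i2 : h2 ∉ R := by simp [hR]
  have i3 : h3 ∉ R := by simp [hR]
  have main := C.pair_lemma hab haO hbO hV hdis hw (by
    intro x hx y hy e1 e2 e3 e4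
    rw [hR] at hx hy
    have := C.K e1 e2 e3 e4 hE
    grind)
  have hOR : O ∪ R = insert h1 (insert h2 (insert h3 R)) := by
    rw [hO]; simp [Finset.insert_union]
  have t2 : ∀ z, C.T2 z O ≤ 2 * (C.w z * (C.w h1 * C.w h2 + C.w h1 * C.w h3 + C.w h2 * C.w h3)) := by
    intro z
    rw [hO, C.T2_expand3 z n12 n13 n23 (by simp) (by simp) (by simp)]
    simp only [T1_empty, T2_empty]
    have := C.psi_le z h1 h2
    have := C.psi_le z h1 h3
    have := C.psi_le z h2 h3
    linarith
  have t2a := t2 a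
  have t2b := t2 b
  have z0 : ∀ h, h ≠ a → h ≠ b → C.T2 h R = 0 := fun h ha' hb' => C.T2_zero (by
    intro y hy z hz e
    rw [hR] at hy hz
    have := hH y z h (C.r1 e)
    grind)
  have z1 := z0 h1 a1 b1
  have z2 := z0 h2 a2 b2
  have z3 := z0 h3 a3 b3
  have z4 : C.T3 R = 0 := C.T3_zero (by
    intro x hx y hy z hz e
    rw [hR] at hx hy hz
    have := hH x y z e
    grind)
  have t3 : C.T3 (O ∪ R) ≤ 6 * (C.w h1 * C.w h2 * C.w h3) +
      6 * ((C.w h1 * C.w h2 + C.w h1 * C.w h3 + C.w h2 * C.w h3) * C.W R) := by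
    rw [hOR, C.T3_expand3 n12 n13 n23 i1 i2 i3, z1, z2, z3, z4]
    have := C.psi_le h1 h2 h3
    have := C.T1_le h1 h2 R
    have := C.T1_le h1 h3 R
    have := C.T1_le h2 h3 R
    linarith
  have hWO : C.W O = C.w h1 + C.w h2 + C.w h3 := by
    rw [hO, C.W_insert (by simp [*]), C.W_insert (by simp [*]), C.W_insert (by simp), C.W_empty]
    ring
  have hsum : C.w a + C.w b + C.W O + C.W R = 1 := by
    rw [C.W_pair hab haO hbO hV hdis, hs]
  have pi := PI_M (C.nn a) (C.nn b) (C.W_nonneg O) (C.W_nonneg R) hsum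
  have wa := C.nn a
  have wb := C.nn b
  have w1 := C.nn h1
  have w2 := C.nn h2
  have w3 := C.nn h3
  have wR := C.W_nonneg R
  rw [hWO] at main pi
  generalize C.w a = A at *
  generalize C.w b = B at *
  generalize C.w h1 = p at *
  generalize C.w h2 = q at *
  generalize C.w h3 = s at *
  generalize C.W R = r at *
  have e2 : p * q + p * s + q * s ≤ (p + q + s) ^ 2 / 3 := by
    nlinarith [sq_nonneg (p - q), sq_nonneg (p - s), sq_nonneg (q - s)]
  have e3 : p * q * s ≤ (p + q + s) ^ 3 / 27 := by
    nlinarith [mul_nonneg w1 (sq_nonneg (q - s)), mul_nonneg w2 (sq_nonneg (p - s)),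
      mul_nonneg w3 (sq_nonneg (p - q)), mul_nonneg (add_nonneg (add_nonneg w1 w2) w3)
      (add_nonneg (add_nonneg (sq_nonneg (p - q)) (sq_nonneg (p - s))) (sq_nonneg (q - s)))]
  have f1 := mul_le_mul_of_nonneg_left e2 wa
  have f2 := mul_le_mul_of_nonneg_left e2 wb
  have f3 := mul_le_mul_of_nonneg_right e2 wR
  linarith

theorem lemM {a b h1 h2 h3 : ℕ} (hs : C.W C.V = 1) (hab : a ≠ b) (ha : a ∈ C.V) (hb : b ∈ C.V)
    (hE : C.E h1 h2 h3) (a1 : h1 ≠ a) (a2 : h2 ≠ a) (a3 : h3 ≠ a)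
    (b1 : h1 ≠ b) (b2 : h2 ≠ b) (b3 : h3 ≠ b)
    (hH : ∀ x y z, C.E x y z → x ≠ a → x ≠ b → x ≠ h1 → x ≠ h2 → x ≠ h3 →
      y ≠ a → y ≠ b → y ≠ h1 → y ≠ h2 → y ≠ h3 → z = a ∨ z = b) :
    C.T3 C.V ≤ 6 * (4811 / 50000) := by
  rcases le_total (C.w b) (C.w a) with h | h
  · exact C.lemM_aux hs hab ha hb hE a1 a2 a3 b1 b2 b3 h hH
  · exact C.lemM_aux hs hab.symm hb ha hE b1 b2 b3 a1 a2 a3 h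
      (fun x y z e x1 x2 x3 x4 x5 y1 y2 y3 y4 y5 =>
        (hH x y z e x2 x1 x3 x4 x5 y2 y1 y3 y4 y5).symm)

end Ctx

namespace Ctx

variable (C : Ctx)

set_option maxHeartbeats 4000000 in
theorem trouble_aux {a b c d e x y : ℕ} (hs : C.W C.V = 1) (abc : C.E a b c) (abd : C.E a b d)
    (acd : C.E a c d) (bcd : C.E b c d) (abe : C.E a b e) (ace : C.E a c e) (bce : C.E b c e)
    (de : d ≠ e) (abx : C.E a b x) (aby : C.E a b y) (axy : C.E a x y) (bxy : C.E b x y)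
    (cx : c ≠ x) (dx : d ≠ x) (ex : e ≠ x) (cy : c ≠ y) (dy : d ≠ y) (ey : e ≠ y)
    (dex : C.E d e x) (hw : C.w b ≤ C.w a) :
    C.T3 C.V ≤ 6 * (4811 / 50000) := by
  have ab := C.ne abc
  have ac := C.ne2 abc
  have bc := C.ne3 abc
  have ad := C.ne2 abd
  have bd := C.ne3 abd
  have ae := C.ne2 abe
  have be := C.ne3 abe
  have ax := C.ne2 abx
  have bx := C.ne3 abx
  have ay := C.ne2 aby
  have by' := C.ne3 aby
  have xy := C.ne3 axy
  have cd := C.ne3 acd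
  have ce := C.ne3 ace
  have hcl : ∀ u v z, C.E u v z → u ≠ a → u ≠ b → v ≠ a → v ≠ b → z ≠ a → z ≠ b →
      ((u = c ∨ v = c ∨ z = c) ∨ (u = d ∨ v = d ∨ z = d) ∧ (u = e ∨ v = e ∨ z = e)) ∧
      (u = x ∨ v = x ∨ z = x ∨ u = y ∨ v = y ∨ z = y) := by
    intro u v z h h1 h2 h3 h4 h5 h6
    have k1 := C.K abc abd acd bcd h
    have k2 := C.K abc abe ace bce h
    have k3 := C.K abx aby axy bxy h
    clear hs abc abd acd bcd abe ace bce abx aby axy bxy dex hw h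
    refine ⟨?_, ?_⟩
    · grind
    · grind
  have ma := C.mem abc
  have mb := C.mem2 abc
  have mc := C.mem3 abc
  have md := C.mem3 abd
  have me := C.mem3 abe
  have mx := C.mem3 abx
  have my := C.mem3 aby
  set R := C.V \ {a, b, c, d, e, x, y} with hRdef
  have hR : ∀ z, z ∈ R ↔ z ∈ C.V ∧ z ≠ a ∧ z ≠ b ∧ z ≠ c ∧ z ≠ d ∧ z ≠ e ∧ z ≠ x ∧ z ≠ y := by
    intro x; simp [hRdef]
  set O : Finset ℕ := insert c (insert d (insert e (insert x (insert y ∅)))) with hO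
  have hV : C.V = insert a (insert b (O ∪ R)) := by
    ext z; simp only [hO, Finset.mem_insert, Finset.mem_union, hR, Finset.notMem_empty]
    grind
  have hdis : Disjoint O R := by
    rw [Finset.disjoint_left]; intro x; simp only [hO, Finset.mem_insert, hR, Finset.notMem_empty]
    grind
  have haO : a ∉ O ∪ R := by
    simp only [hO, Finset.mem_insert, Finset.mem_union, hR, Finset.notMem_empty]; grind
  have hbO : b ∉ O ∪ R := by
    simp only [hO, Finset.mem_insert, Finset.mem_union, hR, Finset.notMem_empty]; grind
  have ic : c ∉ R := by simp [hR]
  have id : d ∉ R := by simp [hR]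
  have ie : e ∉ R := by simp [hR]
  have ix : x ∉ R := by simp [hR]
  have iy : y ∉ R := by simp [hR]
  have main := C.pair_lemma ab haO hbO hV hdis hw (by
    intro u hu v hv e1 e2 e3 e4
    rw [hR] at hu hv
    have := C.K e1 e2 e3 e4 dex
    grind)
  have hOR : O ∪ R = insert c (insert d (insert e (insert x (insert y R)))) := by
    rw [hO]; simp [Finset.insert_union]
  have hsum := C.W_pair ab haO hbO hV hdis
  rw [hs] at hsum
  have hWO : C.W O = C.w c + (C.w d + C.w e) + (C.w x + C.w y) := by
    rw [hO, C.W_insert (by simp [*]), C.W_insert (by simp [*]), C.W_insert (by simp [*]),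
      C.W_insert (by simp [*]), C.W_insert (by simp), C.W_empty]
    ring
  have z2 : ∀ h, h ≠ a → h ≠ b → C.T2 h R = 0 := fun h ha' hb' => C.T2_zero (by
    intro u hu v hv e'
    rw [hR] at hu hv
    have := hcl h u v e'
    grind)
  have z3 : C.T3 R = 0 := C.T3_zero (by
    intro u hu v hv z hz e'
    rw [hR] at hu hv hz
    have := hcl u v z e'
    grind)
  have z1 : ∀ u v, u ≠ a → u ≠ b → v ≠ a → v ≠ b →
      ((u ≠ c ∧ v ≠ c) ∧ (u ≠ d ∧ v ≠ d ∨ u ≠ e ∧ v ≠ e) ∨ (u ≠ x ∧ v ≠ x ∧ u ≠ y ∧ v ≠ y)) →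
      C.T1 u v R = 0 := fun u v h1 h2 h3 h4 h5 => C.T1_zero (by
    intro z hz e'
    rw [hR] at hz
    have := hcl u v z e'
    grind)
  have t3 : C.T3 (O ∪ R) = 6 * (C.psi c d x + C.psi c e x + C.psi d e x + C.psi c d y + C.psi c e y
      + C.psi d e y + C.psi c x y) + 6 * (C.T1 c x R + C.T1 c y R) := by
    rw [hOR, C.T3_expand5 cd ce cx cy de dx dy ex ey xy ic id ie ix iy,
      z2 c ac.symm bc.symm, z2 d ad.symm bd.symm, z2 e ae.symm be.symm, z2 x ax.symm bx.symm,
      z2 y ay.symm by'.symm, z3,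
      z1 c d (by grind) (by grind) (by grind) (by grind) (by grind),
      z1 c e (by grind) (by grind) (by grind) (by grind) (by grind),
      z1 d e (by grind) (by grind) (by grind) (by grind) (by grind),
      z1 d x (by grind) (by grind) (by grind) (by grind) (by grind),
      z1 e x (by grind) (by grind) (by grind) (by grind) (by grind),
      z1 d y (by grind) (by grind) (by grind) (by grind) (by grind),
      z1 e y (by grind) (by grind) (by grind) (by grind) (by grind),
      z1 x y (by grind) (by grind) (by grind) (by grind) (by grind),
      C.psi_zero (a := c) (b := d) (c := e) (fun h => by have := hcl _ _ _ h; grind),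
      C.psi_zero (a := d) (b := x) (c := y) (fun h => by have := hcl _ _ _ h; grind),
      C.psi_zero (a := e) (b := x) (c := y) (fun h => by have := hcl _ _ _ h; grind)]
    ring
  have t2 : ∀ z, C.T2 z O = 2 * (C.psi z c d + C.psi z c e + C.psi z d e + C.psi z c x + C.psi z d x
      + C.psi z e x + C.psi z c y + C.psi z d y + C.psi z e y + C.psi z x y) := by
    intro z
    rw [hO, C.T2_expand5 z cd ce cx cy de dx dy ex ey xy (by simp) (by simp) (by simp) (by simp)
      (by simp)]
    simp only [T1_empty, T2_empty]; ring
  have hK' : ∀ u v z, C.E u v z → u ≠ a → u ≠ b → u ≠ d → u ≠ e → v ≠ a → v ≠ b → v ≠ d →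
      v ≠ e → z ≠ a → z ≠ b → z ≠ d → z ≠ e → C.E a d e → C.E b d e → False := by
    intro u v z h h1 h2 h3 h4 h5 h6 h7 h8 h9 h10 h11 h12 k1 k2
    have := C.K abd abe k1 k2 h
    simp only [h1, h2, h3, h4, h5, h6, h7, h8, h9, h10, h11, h12, or_self] at this
  have hno' : (∃ u v z, C.E u v z ∧ u ≠ a ∧ u ≠ b ∧ u ≠ d ∧ u ≠ e ∧ v ≠ a ∧ v ≠ b ∧ v ≠ d ∧
      v ≠ e ∧ z ≠ a ∧ z ≠ b ∧ z ≠ d ∧ z ≠ e) →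
      C.psi a d e + C.psi b d e ≤ C.w a * (C.w d * C.w e) := by
    rintro ⟨u, v, z, h, h1, h2, h3, h4, h5, h6, h7, h8, h9, h10, h11, h12⟩
    have k := mul_nonneg (C.nn d) (C.nn e)
    have k1 := mul_le_mul_of_nonneg_right hw k
    by_cases hh1 : C.E a d e
    · by_cases hh2 : C.E b d e
      · exact (hK' u v z h h1 h2 h3 h4 h5 h6 h7 h8 h9 h10 h11 h12 hh1 hh2).elim
      · rw [C.psi_zero hh2]; linarith only [C.psi_le a d e, k, k1]
    · rw [C.psi_zero hh1]; linarith only [C.psi_le b d e, k, k1]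
  have hyes : ¬ (∃ u v z, C.E u v z ∧ u ≠ a ∧ u ≠ b ∧ u ≠ d ∧ u ≠ e ∧ v ≠ a ∧ v ≠ b ∧ v ≠ d ∧
      v ≠ e ∧ z ≠ a ∧ z ≠ b ∧ z ≠ d ∧ z ≠ e) →
      C.psi c x y = 0 ∧ C.T1 c x R = 0 ∧ C.T1 c y R = 0 := by
    intro hcase
    refine ⟨C.psi_zero fun h => hcase ⟨c, x, y, h, ?_⟩, C.T1_zero fun z hz h => hcase ⟨c, x, z, h, ?_⟩,
      C.T1_zero fun z hz h => hcase ⟨c, y, z, h, ?_⟩⟩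
    · exact ⟨ac.symm, bc.symm, cd, ce, ax.symm, bx.symm, dx.symm, ex.symm, ay.symm, by'.symm,
        dy.symm, ey.symm⟩
    · rw [hR] at hz
      exact ⟨ac.symm, bc.symm, cd, ce, ax.symm, bx.symm, dx.symm, ex.symm, hz.2.1, hz.2.2.1,
        hz.2.2.2.2.1, hz.2.2.2.2.2.1⟩
    · rw [hR] at hz
      exact ⟨ac.symm, bc.symm, cd, ce, ay.symm, by'.symm, dy.symm, ey.symm, hz.2.1, hz.2.2.1,
        hz.2.2.2.2.1, hz.2.2.2.2.2.1⟩
  have t2' : ∀ z, C.psi z c d + C.psi z c e + C.psi z c x + C.psi z d x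
      + C.psi z e x + C.psi z c y + C.psi z d y + C.psi z e y + C.psi z x y ≤
      C.w z * (C.w c * (C.w d + C.w e) + C.w c * (C.w x + C.w y) +
        (C.w d + C.w e) * (C.w x + C.w y) + C.w x * C.w y) := by
    intro z
    linarith [C.psi_le z c d, C.psi_le z c e, C.psi_le z c x, C.psi_le z d x, C.psi_le z e x,
      C.psi_le z c y, C.psi_le z d y, C.psi_le z e y, C.psi_le z x y]
  have ta := t2' a
  have tb := t2' b
  rw [t3, t2 a, t2 b] at main
  have q1 := C.psi_le c d x
  have q2 := C.psi_le c e x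
  have q3 := C.psi_le d e x
  have q4 := C.psi_le c d y
  have q5 := C.psi_le c e y
  have q6 := C.psi_le d e y
  have wa := C.nn a
  have wb := C.nn b
  have wc := C.nn c
  have wd := C.nn d
  have we := C.nn e
  have wx := C.nn x
  have wy := C.nn y
  have wR := C.W_nonneg R
  have hxy : C.w x * C.w y ≤ (C.w x + C.w y) ^ 2 / 4 := by linarith only [sq_nonneg (C.w x - C.w y)]
  have hde : C.w d * C.w e ≤ (C.w d + C.w e) ^ 2 / 4 := by linarith only [sq_nonneg (C.w d - C.w e)]
  have f1 := mul_le_mul_of_nonneg_left hxy wa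
  have f2 := mul_le_mul_of_nonneg_left hxy wb
  have f3 := mul_le_mul_of_nonneg_left hde wa
  have f4 := mul_le_mul_of_nonneg_left hde wb
  have f5 := mul_le_mul_of_nonneg_left hxy wc
  have f6 := mul_le_mul_of_nonneg_right hde (add_nonneg wx wy)
  by_cases hcase : ∃ u v z, C.E u v z ∧ u ≠ a ∧ u ≠ b ∧ u ≠ d ∧ u ≠ e ∧ v ≠ a ∧ v ≠ b ∧ v ≠ d ∧
      v ≠ e ∧ z ≠ a ∧ z ≠ b ∧ z ≠ d ∧ z ≠ e
  · obtain ⟨u, v, z, h, hh⟩ := hcase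
    have hno := hno' ⟨u, v, z, h, hh⟩
    have q7 := C.psi_le c x y
    have q8 := C.T1_le c x R
    have q9 := C.T1_le c y R
    have pi := PI_Ta wa wb wc (add_nonneg wd we) (add_nonneg wx wy) wR (by linarith)
    rw [hWO] at main
    linarith
  · obtain ⟨y1, y2, y3⟩ := hyes hcase
    rw [y1, y2, y3] at main
    have pi := PI_Tb wa wb (C.W_nonneg O) wR hsum
    have q7 := C.psi_le a d e
    have q8 := C.psi_le b d e
    rw [hWO] at main pi
    have e2 : C.w c * (C.w d + C.w e) + C.w c * (C.w x + C.w y) +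
        (C.w d + C.w e) * (C.w x + C.w y) + C.w x * C.w y + C.w d * C.w e ≤
        2 * (C.w c + (C.w d + C.w e) + (C.w x + C.w y)) ^ 2 / 5 := by
      linarith only [sq_nonneg (C.w c - C.w d), sq_nonneg (C.w c - C.w e), sq_nonneg (C.w c - C.w x),
        sq_nonneg (C.w c - C.w y), sq_nonneg (C.w d - C.w e), sq_nonneg (C.w d - C.w x),
        sq_nonneg (C.w d - C.w y), sq_nonneg (C.w e - C.w x), sq_nonneg (C.w e - C.w y),
        sq_nonneg (C.w x - C.w y)]
    have e3 : C.w c * (C.w d + C.w e) * (C.w x + C.w y) +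
        (C.w d + C.w e) ^ 2 / 4 * (C.w x + C.w y) ≤
        4 * (C.w c + (C.w d + C.w e) + (C.w x + C.w y)) ^ 3 / 81 := by
      have ho := add_nonneg wd we
      have hX := add_nonneg wx wy
      generalize C.w d + C.w e = o at *
      generalize C.w x + C.w y = X at *
      generalize C.w c = v at *
      have amgm : ∀ p q s : ℝ, 0 ≤ p → 0 ≤ q → 0 ≤ s → p * q * s ≤ (p + q + s) ^ 3 / 27 := by
        intro p q s w1 w2 w3
        linarith only [mul_nonneg w1 (sq_nonneg (q - s)), mul_nonneg w2 (sq_nonneg (p - s)),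
          mul_nonneg w3 (sq_nonneg (p - q)), mul_nonneg (add_nonneg (add_nonneg w1 w2) w3)
          (add_nonneg (add_nonneg (sq_nonneg (p - q)) (sq_nonneg (p - s))) (sq_nonneg (q - s)))]
      have := amgm (3 * o / 4) X (v + o / 4) (by linarith) hX (by linarith)
      rw [show 3 * o / 4 + X + (v + o / 4) = v + o + X by ring] at this
      linarith
    have g1 := mul_le_mul_of_nonneg_left e2 wa
    have g2 := mul_le_mul_of_nonneg_left e2 wb
    linarith

theorem trouble {a b c d e x y : ℕ} (hs : C.W C.V = 1) (abc : C.E a b c) (abd : C.E a b d)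
    (acd : C.E a c d) (bcd : C.E b c d) (abe : C.E a b e) (ace : C.E a c e) (bce : C.E b c e)
    (de : d ≠ e) (abx : C.E a b x) (aby : C.E a b y) (axy : C.E a x y) (bxy : C.E b x y)
    (cx : c ≠ x) (dx : d ≠ x) (ex : e ≠ x) (cy : c ≠ y) (dy : d ≠ y) (ey : e ≠ y) {q : ℕ}
    (deq : C.E d e q) (qa : q ≠ a) (qb : q ≠ b) :
    C.T3 C.V ≤ 6 * (4811 / 50000) := by
  have hq : q = x ∨ q = y := by
    have := C.K abx aby axy bxy deq
    have ad := C.ne2 abd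
    have bd := C.ne3 abd
    have ae := C.ne2 abe
    have be := C.ne3 abe
    grind
  rcases hq with rfl | rfl
  · rcases le_total (C.w b) (C.w a) with h | h
    · exact C.trouble_aux hs abc abd acd bcd abe ace bce de abx aby axy bxy cx dx ex cy dy ey deq h
    · exact C.trouble_aux hs (C.s1 abc) (C.s1 abd) bcd acd (C.s1 abe) bce ace de (C.s1 abx)
        (C.s1 aby) bxy axy cx dx ex cy dy ey deq h
  · rcases le_total (C.w b) (C.w a) with h | h
    · exact C.trouble_aux hs abc abd acd bcd abe ace bce de aby abx (C.s2 axy) (C.s2 bxy)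
        cy dy ey cx dx ex deq h
    · exact C.trouble_aux hs (C.s1 abc) (C.s1 abd) bcd acd (C.s1 abe) bce ace de (C.s1 aby)
        (C.s1 abx) (C.s2 bxy) (C.s2 axy) cy dy ey cx dx ex deq h

end Ctx

namespace Ctx

variable (C : Ctx)

theorem W_three {a b c : ℕ} {U : Finset ℕ} (ab : a ≠ b) (ac : a ≠ c) (bc : b ≠ c)
    (ha : a ∉ U) (hb : b ∉ U) (hc : c ∉ U) (hV : C.V = insert a (insert b (insert c U))) :
    C.w a + C.w b + C.w c + C.W U = C.W C.V := by
  rw [hV, C.W_insert (by simp [*]), C.W_insert (by simp [*]), C.W_insert hc]; ring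

theorem key_pair {a b c p q s mu1 mu2 nu1 nu2 : ℝ} {A B D : Prop} [Decidable A] [Decidable B]
    [Decidable D] (hc : 0 ≤ c) (hcb : c ≤ b) (hba : b ≤ a)
    (hp : p = if A then 1 else 0) (hq : q = if B then 1 else 0) (hs : s = if D then 1 else 0)
    (m1 : 0 ≤ mu1) (m1' : mu1 ≤ 1) (m2 : 0 ≤ mu2) (m2' : mu2 ≤ 1)
    (n1 : 0 ≤ nu1) (n1' : nu1 ≤ 1) (n2 : 0 ≤ nu2) (n2' : nu2 ≤ 1)
    (hab : A → B → mu1 = 1 ∨ mu2 = 1) (hac : A → D → nu1 = 1 ∨ nu2 = 1)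
    (hbc : B → D → (mu1 = 1 ∨ nu1 = 1 ∨ b + c - a ≤ c * nu1) ∨
      (mu2 = 1 ∨ nu2 = 1 ∨ b + c - a ≤ c * nu2)) :
    p * a + q * b + s * c ≤ a + b * (1 - (1 - mu1) * (1 - mu2)) + c * (1 - (1 - nu1) * (1 - nu2)) := by
  have hb : 0 ≤ b := hc.trans hcb
  set f := 1 - (1 - mu1) * (1 - mu2) with hf
  set g := 1 - (1 - nu1) * (1 - nu2) with hg
  have f1 : mu1 ≤ f := by nlinarith
  have f2 : mu2 ≤ f := by nlinarith
  have g1 : nu1 ≤ g := by nlinarith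
  have g2 : nu2 ≤ g := by nlinarith
  have bf : 0 ≤ b * f := mul_nonneg hb (m1.trans f1)
  have cg : 0 ≤ c * g := mul_nonneg hc (n1.trans g1)
  have Hab : A → B → b ≤ b * f := by
    intro x y
    have : 1 ≤ f := by rcases hab x y with h | h <;> linarith
    nlinarith
  have Hac : A → D → c ≤ c * g := by
    intro x y
    have : 1 ≤ g := by rcases hac x y with h | h <;> linarith
    nlinarith
  have Hbc : B → D → b + c ≤ a + b * f + c * g := by
    intro x y
    have c1 := mul_le_mul_of_nonneg_left g1 hc
    have c2 := mul_le_mul_of_nonneg_left g2 hc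
    have b1 := mul_le_mul_of_nonneg_left f1 hb
    have b2 := mul_le_mul_of_nonneg_left f2 hb
    rcases hbc x y with (h | h | h) | (h | h | h)
    · rw [h] at b1; linarith
    · rw [h] at c1; linarith
    · linarith
    · rw [h] at b2; linarith
    · rw [h] at c2; linarith
    · linarith
  by_cases hA : A <;> by_cases hB : B <;> by_cases hD : D <;>
    simp only [hA, hB, hD, if_true, if_false, forall_const, false_imp_iff] at hp hq hs Hab Hac Hbc <;>
    rw [hp, hq, hs] <;> linarith

set_option maxHeartbeats 2000000 in
open Classical in
theorem RR_lemma {a b c : ℕ} {R : Finset ℕ} (hcb : C.w c ≤ C.w b) (hba : C.w b ≤ C.w a)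
    (hab : ∀ u ∈ R, ∀ v ∈ R, C.E a b u → C.E a b v → C.E a u v → C.E b u v → False)
    (hac : ∀ u ∈ R, ∀ v ∈ R, C.E a c u → C.E a c v → C.E a u v → C.E c u v → False)
    (hbc : ∀ u ∈ R, ∀ v ∈ R, C.E b c u → C.E b c v → C.E b u v → C.E c u v → False) :
    2 * (C.T1 a b R + C.T1 a c R + C.T1 b c R) + (C.T2 a R + C.T2 b R + C.T2 c R) ≤
    2 * ((C.w a * C.w b + C.w a * C.w c + C.w b * C.w c) * C.W R) + C.w a * C.W R ^ 2
      + (C.w b + C.w c) * (max (C.W R - C.w a) 0) ^ 2 := by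
  have hc := C.nn c
  have hb := C.nn b
  have ha := C.nn a
  set eta := max (C.w b + C.w c - C.w a) 0 with heta
  have eta0 : 0 ≤ eta := le_max_right _ _
  have eta1 : C.w b + C.w c - C.w a ≤ eta := le_max_left _ _
  have eta2 : eta ≤ C.w c := max_le (by linarith) hc
  have eta3 : C.w c * (eta / C.w c) = eta := by
    rcases eq_or_lt_of_le hc with h | h
    · rw [← h]; simp; linarith
    · field_simp
  have eta4 : C.w a * eta ≤ C.w b * C.w c := by
    rcases max_choice (C.w b + C.w c - C.w a) 0 with h | h
    · rw [heta, h]; nlinarith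
    · rw [heta, h]; nlinarith
  set mu : ℕ → ℝ := fun x => if C.E a b x then 0 else 1 with hmu
  set nu : ℕ → ℝ := fun x => if C.E a c x then
    (if C.E a b x ∧ ¬ C.E b c x then eta / C.w c else 0) else 1 with hnu
  have mu0 : ∀ x, 0 ≤ mu x := fun x => by simp only [hmu]; split_ifs <;> norm_num
  have mu1 : ∀ x, mu x ≤ 1 := fun x => by simp only [hmu]; split_ifs <;> norm_num
  have e0 : 0 ≤ eta / C.w c := div_nonneg eta0 hc
  have e1 : eta / C.w c ≤ 1 := div_le_one_of_le₀ eta2 hc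
  have nu0 : ∀ x, 0 ≤ nu x := fun x => by
    simp only [hnu]; split_ifs <;> first | exact e0 | norm_num
  have nu1 : ∀ x, nu x ≤ 1 := fun x => by
    simp only [hnu]; split_ifs <;> first | exact e1 | norm_num
  set M := ∑ x ∈ R, C.w x * mu x with hM
  set N := ∑ x ∈ R, C.w x * nu x with hN
  have hM0 : 0 ≤ M := Finset.sum_nonneg fun x _ => mul_nonneg (C.nn x) (mu0 x)
  have hN0 : 0 ≤ N := Finset.sum_nonneg fun x _ => mul_nonneg (C.nn x) (nu0 x)
  have h1 : C.T1 a b R + C.T1 a c R + C.T1 b c R ≤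
      (C.w a * C.w b + C.w a * C.w c + C.w b * C.w c) * C.W R
        - C.w a * (C.w b * M + C.w c * N) := by
    have e : (C.w a * C.w b + C.w a * C.w c + C.w b * C.w c) * C.W R
        - C.w a * (C.w b * M + C.w c * N) = ∑ x ∈ R, C.w x *
        ((C.w a * C.w b + C.w a * C.w c + C.w b * C.w c)
          - C.w a * (C.w b * mu x + C.w c * nu x)) := by
      rw [hM, hN]; unfold W
      simp only [Finset.mul_sum, ← Finset.sum_add_distrib, ← Finset.sum_sub_distrib]
      exact Finset.sum_congr rfl fun x _ => by ring
    rw [e]; unfold T1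
    rw [← Finset.sum_add_distrib, ← Finset.sum_add_distrib]
    refine Finset.sum_le_sum fun x _ => ?_
    have key : C.chi a b x * (C.w a * C.w b) + C.chi a c x * (C.w a * C.w c)
        + C.chi b c x * (C.w b * C.w c) ≤ (C.w a * C.w b + C.w a * C.w c + C.w b * C.w c)
          - C.w a * (C.w b * mu x + C.w c * nu x) := by
      have p1 := mul_nonneg hb hc
      by_cases u : C.E a b x <;> by_cases v : C.E a c x <;> by_cases t : C.E b c x <;>
        simp only [chi, hmu, hnu, u, v, t, if_true, if_false, and_self, and_true, and_false,
          false_and, true_and, not_true, not_false_iff, eta3] <;> linarith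
    have := mul_le_mul_of_nonneg_left key (C.nn x)
    simp only [psi]; linarith
  have h2 : C.T2 a R + C.T2 b R + C.T2 c R ≤ C.w a * C.W R ^ 2
      + C.w b * (C.W R ^ 2 - (C.W R - M) ^ 2) + C.w c * (C.W R ^ 2 - (C.W R - N) ^ 2) := by
    rw [hM, hN, ← C.dsum R mu, ← C.dsum R nu, ← C.dsum1]
    unfold T2
    simp only [Finset.mul_sum, ← Finset.sum_add_distrib]
    refine Finset.sum_le_sum fun x hx => Finset.sum_le_sum fun y hy => ?_
    have key := key_pair (p := C.chi a x y) (q := C.chi b x y) (s := C.chi c x y)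
      (A := C.E a x y) (B := C.E b x y) (D := C.E c x y) hc hcb hba rfl rfl rfl
      (mu0 x) (mu1 x) (mu0 y) (mu1 y) (nu0 x) (nu1 x) (nu0 y) (nu1 y)
      (by
        intro g1 g2
        by_cases u : C.E a b x
        · right
          have : ¬ C.E a b y := fun v => hab x hx y hy u v g1 g2
          simp [hmu, this]
        · left; simp [hmu, u])
      (by
        intro g1 g2
        by_cases u : C.E a c x
        · right
          have : ¬ C.E a c y := fun v => hac x hx y hy u v g1 g2
          simp [hnu, this]
        · left; simp [hnu, u])
      (by
        intro g1 g2
        have aux : ∀ x, ¬ C.E b c x →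
            (mu x = 1 ∨ nu x = 1 ∨ C.w b + C.w c - C.w a ≤ C.w c * nu x) := by
          intro x h
          by_cases u : C.E a b x
          · by_cases v : C.E a c x
            · right; right
              simp only [hnu, u, v, h, if_true, true_and, not_false_iff, eta3]
              exact eta1
            · right; left; simp [hnu, v]
          · left; simp [hmu, u]
        by_cases u : C.E b c x
        · exact Or.inr (aux y fun v => hbc x hx y hy u v g1 g2)
        · exact Or.inl (aux x u))
    have := mul_le_mul_of_nonneg_left key (mul_nonneg (C.nn x) (C.nn y))
    simp only [psi]; linarith
  have h6 := mul_le_mul_of_nonneg_left (kappa_aux (r := C.W R) (a := C.w a) hM0) hb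
  have h7 := mul_le_mul_of_nonneg_left (kappa_aux (r := C.W R) (a := C.w a) hN0) hc
  linarith

set_option maxHeartbeats 2000000 in
theorem caseD {a b c d e q : ℕ} (hs : C.W C.V = 1) (abc : C.E a b c) (abd : C.E a b d)
    (acd : C.E a c d) (bcd : C.E b c d) (abe : C.E a b e) (ace : C.E a c e) (bce : C.E b c e)
    (de : d ≠ e) (deq : C.E d e q) (qa : q ≠ a) (qb : q ≠ b) (qc : q ≠ c)
    (hcb : C.w c ≤ C.w b) (hba : C.w b ≤ C.w a) :
    C.T3 C.V ≤ 6 * (4811 / 50000) := by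
  have ab := C.ne abc
  have ac := C.ne2 abc
  have bc := C.ne3 abc
  have ad := C.ne2 abd
  have bd := C.ne3 abd
  have ae := C.ne2 abe
  have be := C.ne3 abe
  have cd := C.ne3 acd
  have ce := C.ne3 ace
  by_cases hK5 : C.E a d e ∧ C.E b d e ∧ C.E c d e
  · obtain ⟨ade, bde, cde⟩ := hK5
    refine C.lemM hs ab (C.mem abc) (C.mem2 abc) cde ac.symm ad.symm ae.symm bc.symm bd.symm
      be.symm ?_
    intro x y z h x1 x2 x3 x4 x5 y1 y2 y3 y4 y5
    have k1 := C.K abc abd acd bcd h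
    have k2 := C.K abc abe ace bce h
    have k3 := C.K abd abe ade bde h
    simp only [x1, x2, x3, x4, x5, y1, y2, y3, y4, y5, false_or, or_false] at k1 k2 k3
    clear hs
    grind
  set R := C.V \ {a, b, c, d, e} with hRdef
  have hR : ∀ x, x ∈ R ↔ x ∈ C.V ∧ x ≠ a ∧ x ≠ b ∧ x ≠ c ∧ x ≠ d ∧ x ≠ e := by
    intro x; simp [hRdef]
  by_contra hcon
  have RR := C.RR_lemma (a := a) (b := b) (c := c) (R := R) hcb hba
    (by
      intro u hu v hv h1 h2 h3 h4
      rw [hR] at hu hv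
      obtain ⟨-, -, -, u3, u4, u5⟩ := hu
      obtain ⟨-, -, -, v3, v4, v5⟩ := hv
      exact hcon (C.trouble hs abc abd acd bcd abe ace bce de h1 h2 h3 h4 u3.symm u4.symm u5.symm
        v3.symm v4.symm v5.symm deq qa qb))
    (by
      intro u hu v hv h1 h2 h3 h4
      rw [hR] at hu hv
      obtain ⟨-, -, u3, -, u4, u5⟩ := hu
      obtain ⟨-, -, v3, -, v4, v5⟩ := hv
      exact hcon (C.trouble hs (C.s2 abc) acd abd (C.s1 bcd) ace abe (C.s1 bce) de h1 h2 h3 h4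
        u3.symm u4.symm u5.symm v3.symm v4.symm v5.symm deq qa qc))
    (by
      intro u hu v hv h1 h2 h3 h4
      rw [hR] at hu hv
      obtain ⟨-, u3, -, -, u4, u5⟩ := hu
      obtain ⟨-, v3, -, -, v4, v5⟩ := hv
      exact hcon (C.trouble hs (C.r1 abc) bcd (C.s1 abd) (C.s1 acd) bce (C.s1 abe) (C.s1 ace) de
        h1 h2 h3 h4 u3.symm u4.symm u5.symm v3.symm v4.symm v5.symm deq qb qc))
  apply hcon
  have hmeet : ∀ x y z, C.E x y z → x ≠ a → x ≠ b → x ≠ c → y ≠ a → y ≠ b → y ≠ c →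
      z ≠ a → z ≠ b → z ≠ c → (x = d ∨ y = d ∨ z = d) ∧ (x = e ∨ y = e ∨ z = e) := by
    intro x y z h x1 x2 x3 y1 y2 y3 z1 z2 z3
    have k1 := C.K abc abd acd bcd h
    have k2 := C.K abc abe ace bce h
    simp only [x1, x2, x3, y1, y2, y3, z1, z2, z3, false_or] at k1 k2
    exact ⟨k1, k2⟩
  have z3 : C.T3 R = 0 := C.T3_zero (by
    intro x hx y hy z hz h
    rw [hR] at hx hy hz
    have := hmeet x y z h
    grind)
  have zd : C.T2 d R = 0 := C.T2_zero (by
    intro y hy z hz h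
    rw [hR] at hy hz
    have := hmeet d y z h
    grind)
  have ze : C.T2 e R = 0 := C.T2_zero (by
    intro y hy z hz h
    rw [hR] at hy hz
    have := hmeet e y z h
    grind)
  have ma := C.mem abc
  have mb := C.mem2 abc
  have mc := C.mem3 abc
  have md := C.mem3 abd
  have me := C.mem3 abe
  have hV : C.V = insert a (insert b (insert c (insert d (insert e R)))) := by
    ext z; simp only [Finset.mem_insert, hR]
    grind
  have ia : a ∉ R := by simp [hR]
  have ib : b ∉ R := by simp [hR]
  have ic : c ∉ R := by simp [hR]
  have id : d ∉ R := by simp [hR]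
  have ie : e ∉ R := by simp [hR]
  have hsum : C.w a + C.w b + C.w c + (C.w d + C.w e) + C.W R = 1 := by
    rw [← hs, C.W_three ab ac bc (by simp [ad, ae, ia]) (by simp [bd, be, ib])
      (by simp [cd, ce, ic]) hV |>.symm, C.W_insert (by simp [de, id]), C.W_insert ie]
    ring
  have wa := C.nn a
  have wb := C.nn b
  have wc := C.nn c
  have wd := C.nn d
  have we := C.nn e
  have wR := C.W_nonneg R
  have hexp := C.T3_expand5 ab ac ad ae bc bd be cd ce de ia ib ic id ie
  rw [← hV, z3, zd, ze] at hexp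
  have h3 : C.psi a d e + C.psi b d e + C.psi c d e ≤ (C.w a + C.w b) * (C.w d * C.w e) := by
    have k := mul_nonneg wd we
    have k1 := mul_le_mul_of_nonneg_right hcb k
    have k2 := mul_le_mul_of_nonneg_right hba k
    have j1 := C.psi_le a d e
    have j2 := C.psi_le b d e
    have j3 := C.psi_le c d e
    by_cases h1 : C.E a d e
    · by_cases h2 : C.E b d e
      · have h3 : ¬ C.E c d e := fun h => hK5 ⟨h1, h2, h⟩
        rw [C.psi_zero h3]; linarith only [k, k1, k2, j1, j2, j3]
      · rw [C.psi_zero h2]; linarith only [k, k1, k2, j1, j2, j3]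
    · rw [C.psi_zero h1]; linarith only [k, k1, k2, j1, j2, j3]
  have hde : C.w d * C.w e ≤ (C.w d + C.w e) ^ 2 / 4 := by
    linarith only [sq_nonneg (C.w d - C.w e)]
  have f1 := mul_le_mul_of_nonneg_left hde (add_nonneg wa wb)
  have f2 := mul_le_mul_of_nonneg_right hde wR
  have pi := PI_D hba hcb wc (add_nonneg wd we) wR hsum
  have j1 := C.psi_le a b c
  have j2 := C.psi_le a b d
  have j3 := C.psi_le a c d
  have j4 := C.psi_le b c d
  have j5 := C.psi_le a b e
  have j6 := C.psi_le a c e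
  have j7 := C.psi_le b c e
  have l1 := C.T1_le a d R
  have l2 := C.T1_le b d R
  have l3 := C.T1_le c d R
  have l4 := C.T1_le a e R
  have l5 := C.T1_le b e R
  have l6 := C.T1_le c e R
  have l7 := C.T1_le d e R
  linarith only [hexp, RR, h3, f1, f2, pi, j1, j2, j3, j4, j5, j6, j7, l1, l2, l3, l4, l5, l6, l7]

end Ctx

namespace Ctx

variable (C : Ctx)

theorem caseII {i j k u v : ℕ} (hs : C.W C.V = 1)
    (hA : ∀ x y z, C.E x y z → (x = i ∨ x = j ∨ x = k) ∨ (y = i ∨ y = j ∨ y = k) ∨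
      (z = i ∨ z = j ∨ z = k))
    (hij : i ≠ j) (ik : k ≠ i) (jk : k ≠ j)
    (iu : C.E i u v) (ju : C.E j u v) (ku : C.E k u v) (iju : C.E i j u) (ijv : C.E i j v) :
    C.T3 C.V ≤ 6 * (4811 / 50000) := by
  have h1 := C.ne2 iju
  have h2 := C.ne2 ijv
  have h3 := C.ne3 iju
  have h4 := C.ne3 ijv
  have h5 := C.ne ku
  have h6 := C.ne2 ku
  refine C.lemM hs hij (C.mem iju) (C.mem2 iju) ku ik h1.symm h2.symm jk h3.symm h4.symm ?_
  intro x y z e x1 x2 x3 x4 x5 y1 y2 y3 y4 y5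
  have a1 := hA x y z e
  have a2 := C.K iju ijv iu ju e
  grind

noncomputable def g (a x : ℕ) (U : Finset ℕ) : ℝ := ∑ z ∈ U, C.chi a x z * C.w z

theorem g_le (a x : ℕ) (U : Finset ℕ) : C.g a x U ≤ C.W U :=
  Finset.sum_le_sum fun z _ => mul_le_of_le_one_left (C.nn z) (C.chi_le a x z)

theorem T1_g (a x : ℕ) (U : Finset ℕ) : C.T1 x a U = C.w x * (C.w a * C.g a x U) := by
  unfold T1 g
  rw [Finset.mul_sum, Finset.mul_sum]
  refine Finset.sum_congr rfl fun z _ => ?_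
  rw [psi, C.chi_s1]; ring

theorem chi_add {a b x y : ℕ} (h : ¬ (C.E a b x ∧ C.E a b y)) :
    C.chi a b x + C.chi a b y ≤ 1 := by
  have h1 := C.chi_le a b x
  have h2 := C.chi_le a b y
  by_cases h3 : C.E a b x
  · rw [C.chi_zero fun h4 => h ⟨h3, h4⟩]; linarith only [h1]
  · rw [C.chi_zero h3]; linarith only [h2]

theorem chi_add3 {a b x y z : ℕ} (h : ¬ (C.E a b x ∧ C.E a b y)) (h' : ¬ (C.E a b x ∧ C.E a b z))
    (h'' : ¬ (C.E a b y ∧ C.E a b z)) :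
    C.chi a b x + C.chi a b y + C.chi a b z ≤ 1 := by
  by_cases h3 : C.E a b x
  · rw [C.chi_zero fun h4 => h ⟨h3, h4⟩, C.chi_zero fun h4 => h' ⟨h3, h4⟩]
    linarith only [C.chi_le a b x]
  · rw [C.chi_zero h3]; linarith only [C.chi_add h'']

theorem case1 {a b c : ℕ} (hs : C.W C.V = 1) (abc : C.E a b c)
    (hA : ∀ x y z, C.E x y z → (x = a ∨ x = b ∨ x = c) ∨ (y = a ∨ y = b ∨ y = c) ∨
      (z = a ∨ z = b ∨ z = c))
    (hcb : C.w c ≤ C.w b) (hba : C.w b ≤ C.w a)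
    (pos : ∀ v ∈ C.V, 0 < C.w v) (der : ∀ v ∈ C.V, C.w v * C.T3 C.V ≤ C.T2 v C.V)
    (hL : Real.sqrt 3 / 3 < C.T3 C.V) : False := by
  have ab := C.ne abc
  have ac := C.ne2 abc
  have bc := C.ne3 abc
  have hc := c_lt
  have wa := C.nn a
  have wb := C.nn b
  have wc := C.nn c
  obtain ⟨U, hU⟩ : ∃ U : Finset ℕ, ∀ z, z ∈ U ↔ z ∈ C.V ∧ z ≠ a ∧ z ≠ b ∧ z ≠ c :=
    ⟨C.V.filter fun z => z ≠ a ∧ z ≠ b ∧ z ≠ c, by simp⟩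
  have ma := C.mem abc
  have mb := C.mem2 abc
  have mc := C.mem3 abc
  have hV : C.V = insert a (insert b (insert c U)) := by
    ext z; simp only [Finset.mem_insert, hU]
    grind
  have ia : a ∉ U := by simp [hU]
  have ib : b ∉ U := by simp [hU]
  have ic : c ∉ U := by simp [hU]
  have hsum := C.W_three ab ac bc ia ib ic hV
  rw [hs] at hsum
  have wU := C.W_nonneg U
  have nE : ∀ x ∈ U, ∀ y ∈ U, ∀ z ∈ U, ¬ C.E x y z := by
    intro x hx y hy z hz h
    rw [hU] at hx hy hz
    have := hA x y z h
    grind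
  have hP : ∀ p q r : ℝ, 0 ≤ p → p ≤ 1 → 0 ≤ q → q ≤ 1 → 0 ≤ r → r ≤ 1 →
      p * (C.w a * C.w b) + q * (C.w a * C.w c) + r * (C.w b * C.w c) ≤
        C.w a * C.w b + C.w a * C.w c + C.w b * C.w c := by
    intro p q r _ p1 _ q1 _ r1
    have t1 := mul_le_of_le_one_left (mul_nonneg wa wb) p1
    have t2 := mul_le_of_le_one_left (mul_nonneg wa wc) q1
    have t3 := mul_le_of_le_one_left (mul_nonneg wb wc) r1
    linarith only [t1, t2, t3]
  by_cases hfull : ∃ u ∈ U, ∃ v ∈ U, C.E a u v ∧ C.E b u v ∧ C.E c u v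
  · have hdeg : ∀ x ∈ U, C.T3 C.V ≤ 2 * (C.chi a b x * (C.w a * C.w b)
        + C.chi a c x * (C.w a * C.w c) + C.chi b c x * (C.w b * C.w c)
        + (C.w a * C.g a x U + C.w b * C.g b x U + C.w c * C.g c x U)) := by
      intro x hx
      have hxV := ((hU x).1 hx).1
      have h1 := der x hxV
      have h2 := C.T2_expand3 x ab ac bc ia ib ic
      rw [← hV, C.T2_zero (nE x hx), C.T1_g, C.T1_g, C.T1_g] at h2
      have e1 : C.psi x a b = C.w x * (C.chi a b x * (C.w a * C.w b)) := by
        rw [C.psi_s1, C.psi_s2, psi]; ring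
      have e2 : C.psi x a c = C.w x * (C.chi a c x * (C.w a * C.w c)) := by
        rw [C.psi_s1, C.psi_s2, psi]; ring
      have e3 : C.psi x b c = C.w x * (C.chi b c x * (C.w b * C.w c)) := by
        rw [C.psi_s1, C.psi_s2, psi]; ring
      rw [e1, e2, e3] at h2
      refine le_of_mul_le_mul_left ?_ (pos x hxV)
      rw [h2] at h1
      linarith only [h1]
    have ncom : ∀ u v, C.E a u v → C.E b u v → C.E c u v →
        (¬ (C.E a b u ∧ C.E a b v)) ∧ (¬ (C.E a c u ∧ C.E a c v)) ∧
          (¬ (C.E b c u ∧ C.E b c v)) := by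
      intro u v h1 h2 h3
      refine ⟨fun h => ?_, fun h => ?_, fun h => ?_⟩
      · have := C.caseII hs hA ab ac.symm bc.symm h1 h2 h3 h.1 h.2
        linarith only [this, hc, hL]
      · have := C.caseII (i := a) (j := c) (k := b) hs
          (fun x y z e => by have := hA x y z e; clear hdeg hV hP nE; grind)
          ac ab.symm bc h1 h3 h2 h.1 h.2
        linarith only [this, hc, hL]
      · have := C.caseII (i := b) (j := c) (k := a) hs
          (fun x y z e => by have := hA x y z e; clear hdeg hV hP nE; grind)
          bc ab ac h2 h3 h1 h.1 h.2
        linarith only [this, hc, hL]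
    obtain ⟨u, hu, v, hv, au, bu, cu⟩ := hfull
    have nuv := ncom u v au bu cu
    have du := hdeg u hu
    have dv := hdeg v hv
    have hq : (1.732 : ℝ) < Real.sqrt 3 := Real.lt_sqrt_of_sq_lt (by norm_num)
    have gb : ∀ x, C.w a * C.g a x U + C.w b * C.g b x U + C.w c * C.g c x U ≤
        (C.w a + C.w b + C.w c) * C.W U := by
      intro x
      have t1 := mul_le_mul_of_nonneg_left (C.g_le a x U) wa
      have t2 := mul_le_mul_of_nonneg_left (C.g_le b x U) wb
      have t3 := mul_le_mul_of_nonneg_left (C.g_le c x U) wc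
      linarith only [t1, t2, t3]
    by_cases hz : ∃ z ∈ U, (C.E a u z ∧ C.E b u z ∧ C.E c u z) ∧
        (C.E a v z ∧ C.E b v z ∧ C.E c v z)
    · obtain ⟨z, hzU, ⟨z1, z2, z3⟩, z4, z5, z6⟩ := hz
      have nuz := ncom u z z1 z2 z3
      have nvz := ncom v z z4 z5 z6
      have dz := hdeg z hzU
      have gu := gb u
      have gv := gb v
      have gz := gb z
      have k1 := C.chi_add3 nuv.1 nuz.1 nvz.1
      have k2 := C.chi_add3 nuv.2.1 nuz.2.1 nvz.2.1
      have k3 := C.chi_add3 nuv.2.2 nuz.2.2 nvz.2.2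
      have t1 := mul_le_of_le_one_left (mul_nonneg wa wb) k1
      have t2 := mul_le_of_le_one_left (mul_nonneg wa wc) k2
      have t3 := mul_le_of_le_one_left (mul_nonneg wb wc) k3
      have hy : C.W U = 1 - (C.w a + C.w b + C.w c) := by linarith only [hsum]
      rw [hy] at gu gv gz
      have q1 := sq_nonneg (C.w a - C.w b)
      have q2 := sq_nonneg (C.w a - C.w c)
      have q3 := sq_nonneg (C.w b - C.w c)
      have q4 := sq_nonneg (C.w a + C.w b + C.w c - 9 / 16)
      norm_num at hq
      linarith only [gu, gv, gz, t1, t2, t3, du, dv, dz, q1, q2, q3, q4, hq, hL]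
    · have k1 := C.chi_add nuv.1
      have k2 := C.chi_add nuv.2.1
      have k3 := C.chi_add nuv.2.2
      have t1 := mul_le_of_le_one_left (mul_nonneg wa wb) k1
      have t2 := mul_le_of_le_one_left (mul_nonneg wa wc) k2
      have t3 := mul_le_of_le_one_left (mul_nonneg wb wc) k3
      have hg : C.w a * C.g a u U + C.w b * C.g b u U + C.w c * C.g c u U
          + (C.w a * C.g a v U + C.w b * C.g b v U + C.w c * C.g c v U) ≤
          (2 * C.w a + 2 * C.w b + C.w c) * C.W U := by
        unfold g W
        simp only [Finset.mul_sum, ← Finset.sum_add_distrib]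
        refine Finset.sum_le_sum fun z hzU => ?_
        have key : C.w a * C.chi a u z + C.w b * C.chi b u z + C.w c * C.chi c u z
          + (C.w a * C.chi a v z + C.w b * C.chi b v z + C.w c * C.chi c v z) ≤
          2 * C.w a + 2 * C.w b + C.w c := by
          have m1 := mul_le_of_le_one_right wa (C.chi_le a u z)
          have m2 := mul_le_of_le_one_right wb (C.chi_le b u z)
          have m3 := mul_le_of_le_one_right wc (C.chi_le c u z)
          have m4 := mul_le_of_le_one_right wa (C.chi_le a v z)
          have m5 := mul_le_of_le_one_right wb (C.chi_le b v z)
          have m6 := mul_le_of_le_one_right wc (C.chi_le c v z)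
          have hn : ¬ ((C.E a u z ∧ C.E b u z ∧ C.E c u z) ∧
            (C.E a v z ∧ C.E b v z ∧ C.E c v z)) := fun h => hz ⟨z, hzU, h⟩
          by_cases r1 : C.E a u z
          · by_cases r2 : C.E b u z
            · by_cases r3 : C.E c u z
              · by_cases r4 : C.E a v z
                · by_cases r5 : C.E b v z
                  · have r6 : ¬ C.E c v z := fun r6 => hn ⟨⟨r1, r2, r3⟩, r4, r5, r6⟩
                    rw [C.chi_zero r6]; linarith only [m1, m2, m3, m4, m5, m6, hcb, hba]
                  · rw [C.chi_zero r5]; linarith only [m1, m2, m3, m4, m5, m6, hcb, hba]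
                · rw [C.chi_zero r4]; linarith only [m1, m2, m3, m4, m5, m6, hcb, hba]
              · rw [C.chi_zero r3]; linarith only [m1, m2, m3, m4, m5, m6, hcb, hba]
            · rw [C.chi_zero r2]; linarith only [m1, m2, m3, m4, m5, m6, hcb, hba]
          · rw [C.chi_zero r1]; linarith only [m1, m2, m3, m4, m5, m6, hcb, hba]
        have := mul_le_mul_of_nonneg_right key (C.nn z)
        linarith only [this]
      have hy : C.W U = 1 - (C.w a + C.w b + C.w c) := by linarith only [hsum]
      rw [hy] at hg
      norm_num at hq
      have hT : C.T3 C.V ≤ (C.w a * C.w b + C.w a * C.w c + C.w b * C.w c)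
        + (2 * C.w a + 2 * C.w b + C.w c) * (1 - (C.w a + C.w b + C.w c)) := by
        linarith only [hg, t1, t2, t3, du, dv]
      clear * - hT hq hL wa wb wc
      have q1 := sq_nonneg (C.w a - C.w b)
      have q2 := sq_nonneg (C.w a + C.w b - 4 / 7 + 4 / 7 * C.w c)
      have q3 := sq_nonneg (C.w c)
      linarith only [hT, q1, q2, q3, hq, hL, wc]
  · have hexp := C.T3_expand3 ab ac bc ia ib ic
    rw [← hV, C.T3_zero nE] at hexp
    have h2 : C.T2 a U + C.T2 b U + C.T2 c U ≤ (C.w a + C.w b) * C.W U ^ 2 := by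
      rw [← C.dsum1 U]
      unfold T2
      simp only [Finset.mul_sum, ← Finset.sum_add_distrib]
      refine Finset.sum_le_sum fun y hy => Finset.sum_le_sum fun z hz => ?_
      have k := mul_nonneg (C.nn y) (C.nn z)
      have k1 := mul_le_mul_of_nonneg_right hcb k
      have k2 := mul_le_mul_of_nonneg_right hba k
      have j1 := C.psi_le a y z
      have j2 := C.psi_le b y z
      have j3 := C.psi_le c y z
      by_cases h1 : C.E a y z
      · by_cases h2 : C.E b y z
        · have h3 : ¬ C.E c y z := fun h => hfull ⟨y, hy, z, hz, h1, h2, h⟩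
          rw [C.psi_zero h3]; linarith only [k, k1, k2, j1, j2, j3]
        · rw [C.psi_zero h2]; linarith only [k, k1, k2, j1, j2, j3]
      · rw [C.psi_zero h1]; linarith only [k, k1, k2, j1, j2, j3]
    have l1 := C.T1_le a b U
    have l2 := C.T1_le a c U
    have l3 := C.T1_le b c U
    have l4 := C.psi_le a b c
    have hp := PI_S wa wb (add_nonneg wU wc) (by linarith only [hsum])
    have hn := mul_nonneg (add_nonneg wa wb) (sq_nonneg (C.w c))
    linarith only [hexp, h2, l1, l2, l3, l4, hp, hn, hL]

end Ctx

namespace Ctx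

variable (C : Ctx)

theorem final_aux {a b c d e : ℕ} (hs : C.W C.V = 1) (abc : C.E a b c) (abd : C.E a b d)
    (acd : C.E a c d) (bcd : C.E b c d) (abe : C.E a b e) (ace : C.E a c e) (bce : C.E b c e)
    (de : d ≠ e) (hcb : C.w c ≤ C.w b) (hba : C.w b ≤ C.w a)
    (pos : ∀ v ∈ C.V, 0 < C.w v) (der : ∀ v ∈ C.V, C.w v * C.T3 C.V ≤ C.T2 v C.V)
    (hL : Real.sqrt 3 / 3 < C.T3 C.V) : False := by
  by_cases hA : ∀ x y z, C.E x y z → (x = a ∨ x = b ∨ x = c) ∨ (y = a ∨ y = b ∨ y = c) ∨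
      (z = a ∨ z = b ∨ z = c)
  · exact C.case1 hs abc hA hcb hba pos der hL
  · push Not at hA
    obtain ⟨x, y, z, h, ⟨x1, x2, x3⟩, ⟨y1, y2, y3⟩, z1, z2, z3⟩ := hA
    have main : ∀ q, C.E d e q → q ≠ a → q ≠ b → q ≠ c → False := by
      intro q hq qa qb qc
      have := C.caseD hs abc abd acd bcd abe ace bce de hq qa qb qc hcb hba
      linarith only [this, hL, c_lt]
    have k1 := C.K abc abd acd bcd h
    have k2 := C.K abc abe ace bce h
    have k1 : x = d ∨ y = d ∨ z = d := by tauto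
    have k2 : x = e ∨ y = e ∨ z = e := by tauto
    rcases k1 with rfl | rfl | rfl <;> rcases k2 with rfl | rfl | rfl
    · exact de rfl
    · exact main z h z1 z2 z3
    · exact main y (C.s2 h) y1 y2 y3
    · exact main z (C.s1 h) z1 z2 z3
    · exact de rfl
    · exact main x (C.r1 h) x1 x2 x3
    · exact main y (C.r2 h) y1 y2 y3
    · exact main x (C.s3 h) x1 x2 x3
    · exact de rfl

theorem final {a b c d e : ℕ} (hs : C.W C.V = 1) (abc : C.E a b c) (abd : C.E a b d)
    (acd : C.E a c d) (bcd : C.E b c d) (abe : C.E a b e) (ace : C.E a c e) (bce : C.E b c e)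
    (de : d ≠ e)
    (pos : ∀ v ∈ C.V, 0 < C.w v) (der : ∀ v ∈ C.V, C.w v * C.T3 C.V ≤ C.T2 v C.V)
    (hL : Real.sqrt 3 / 3 < C.T3 C.V) : False := by
  rcases le_total (C.w a) (C.w b) with h1 | h1 <;> rcases le_total (C.w a) (C.w c) with h2 | h2 <;>
    rcases le_total (C.w b) (C.w c) with h3 | h3
  · exact C.final_aux hs (C.s3 abc) (C.s1 bcd) (C.s1 acd) (C.s1 abd) (C.s1 bce) (C.s1 ace)
      (C.s1 abe) de h1 h3 pos der hL
  · exact C.final_aux hs (C.r1 abc) bcd (C.s1 abd) (C.s1 acd) bce (C.s1 abe) (C.s1 ace)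
      de h2 h3 pos der hL
  · exact C.final_aux hs (C.s3 abc) (C.s1 bcd) (C.s1 acd) (C.s1 abd) (C.s1 bce) (C.s1 ace)
      (C.s1 abe) de h1 h3 pos der hL
  · exact C.final_aux hs (C.s1 abc) (C.s1 abd) bcd acd (C.s1 abe) bce ace
      de h2 h1 pos der hL
  · exact C.final_aux hs (C.r2 abc) (C.s1 acd) (C.s1 bcd) abd (C.s1 ace) (C.s1 bce) abe
      de h1 h2 pos der hL
  · exact C.final_aux hs abc abd acd bcd abe ace bce de h3 h1 pos der hL
  · exact C.final_aux hs (C.s2 abc) acd abd (C.s1 bcd) ace abe (C.s1 bce)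
      de h3 h2 pos der hL
  · exact C.final_aux hs abc abd acd bcd abe ace bce de h3 h1 pos der hL

end Ctx

theorem exists_opt {r : ℕ} (G : HyperGraph r) (hne : G.verts.Nonempty) :
    ∃ w : ℕ → ℝ, (∀ v, 0 ≤ w v) ∧ ∑ v ∈ G.verts, w v = 1 ∧ G.lagFun w = G.lag ∧
      ∀ w', G.IsFeasible w' → G.lagFun w' ≤ G.lag := by
  let S : Set (ℕ → ℝ) := {w | (∀ v, 0 ≤ w v) ∧ (∀ v, v ∉ G.verts → w v = 0) ∧
    ∑ v ∈ G.verts, w v = 1}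
  have hcl : IsClosed S := by
    have hSe : S = (⋂ v, {w : ℕ → ℝ | 0 ≤ w v}) ∩ ((⋂ v, ⋂ (_ : v ∉ G.verts),
        {w : ℕ → ℝ | w v = 0}) ∩ {w : ℕ → ℝ | ∑ v ∈ G.verts, w v = 1}) := by
      ext w; simp [S]
    rw [hSe]
    refine IsClosed.inter ?_ (IsClosed.inter ?_ ?_)
    · exact isClosed_iInter fun v => isClosed_le continuous_const (continuous_apply v)
    · exact isClosed_iInter fun v => isClosed_iInter fun _ =>
        isClosed_eq (continuous_apply v) continuous_const
    · exact isClosed_eq (continuous_finsetSum _ fun v _ => continuous_apply v) continuous_const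
  have hsub : S ⊆ Set.pi Set.univ fun _ => Set.Icc (0 : ℝ) 1 := by
    rintro w ⟨h1, h2, h3⟩ v -
    refine ⟨h1 v, ?_⟩
    by_cases hv : v ∈ G.verts
    · rw [← h3]; exact Finset.single_le_sum (fun i _ => h1 i) hv
    · rw [h2 v hv]; norm_num
  have hcomp : IsCompact S := (isCompact_univ_pi fun _ => isCompact_Icc).of_isClosed_subset hcl hsub
  obtain ⟨v0, hv0⟩ := hne
  have hSne : S.Nonempty := by
    refine ⟨fun v => if v = v0 then 1 else 0, ?_, ?_, ?_⟩
    · intro v; dsimp only; split_ifs <;> norm_num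
    · intro v hv; dsimp only; rw [if_neg]; rintro rfl; exact hv hv0
    · simp [hv0]
  have hcont : Continuous G.lagFun := by
    unfold HyperGraph.lagFun
    exact continuous_finsetSum _ fun e _ => continuous_finsetProd _ fun v _ => continuous_apply v
  obtain ⟨w, hwS, hmax⟩ := hcomp.exists_isMaxOn hSne hcont.continuousOn
  have hall : ∀ w', G.IsFeasible w' → G.lagFun w' ≤ G.lagFun w := by
    rintro w' ⟨h1, h2⟩
    have hin : (fun v => if v ∈ G.verts then w' v else 0) ∈ S := by
      refine ⟨?_, ?_, ?_⟩
      · intro v; dsimp only; split_ifs with h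
        · exact h1 v h
        · exact le_rfl
      · intro v hv; simp [hv]
      · rw [← h2]; exact Finset.sum_congr rfl fun v hv => by simp [hv]
    have heq : G.lagFun (fun v => if v ∈ G.verts then w' v else 0) = G.lagFun w' := by
      unfold HyperGraph.lagFun
      refine Finset.sum_congr rfl fun e he => Finset.prod_congr rfl fun v hv => ?_
      simp [G.edges_sub e he hv]
    rw [← heq]; exact hmax hin
  have hlag : G.lag = G.lagFun w := by
    refine IsGreatest.csSup_eq ⟨⟨w, ⟨fun v _ => hwS.1 v, hwS.2.2⟩, rfl⟩, ?_⟩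
    rintro x ⟨w', hw', rfl⟩
    exact hall w' hw'
  exact ⟨w, hwS.1, hwS.2.2, hlag.symm, fun w' h => hlag ▸ hall w' h⟩

theorem lagFun_hom (G : ThreeGraph) (hopt : ∀ w', G.IsFeasible w' → G.lagFun w' ≤ G.lag)
    (w : ℕ → ℝ) (h0 : ∀ v, 0 ≤ w v) (hp : 0 < ∑ v ∈ G.verts, w v) :
    G.lagFun w ≤ G.lag * (∑ v ∈ G.verts, w v) ^ 3 := by
  set σ := ∑ v ∈ G.verts, w v with hσ
  have h1 := hopt (fun v => w v / σ) ⟨fun v _ => div_nonneg (h0 v) hp.le, by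
    rw [← Finset.sum_div]; exact div_self hp.ne'⟩
  have h2 : G.lagFun (fun v => w v / σ) = G.lagFun w / σ ^ 3 := by
    unfold HyperGraph.lagFun
    rw [Finset.sum_div]
    refine Finset.sum_congr rfl fun e he => ?_
    rw [Finset.prod_div_distrib, Finset.prod_const, G.card_eq e he]
  rw [h2, div_le_iff₀ (pow_pos hp 3)] at h1
  exact h1

theorem edge_distinct (G : ThreeGraph) {a b c : ℕ} (h : ({a, b, c} : Finset ℕ) ∈ G.edges) :
    a ≠ b ∧ a ≠ c ∧ b ≠ c := by
  have := G.card_eq _ h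
  refine ⟨?_, ?_, ?_⟩ <;> rintro rfl
  · have h2 := Finset.card_le_two (a := a) (b := c)
    rw [Finset.insert_eq_of_mem (by simp)] at this; omega
  · have h2 := Finset.card_le_two (a := b) (b := a)
    rw [Finset.insert_eq_of_mem (by simp)] at this; omega
  · have h2 := Finset.card_le_two (a := a) (b := b)
    rw [Finset.pair_eq_singleton] at this
    have h3 := Finset.card_le_two (a := a) (b := b)
    omega

theorem triple_sum (V : Finset ℕ) (w : ℕ → ℝ) {e : Finset ℕ} (he : e ⊆ V) (hc : e.card = 3) :
    ∑ x ∈ V, ∑ y ∈ V, ∑ z ∈ V, (if ({x, y, z} : Finset ℕ) = e then w x * w y * w z else 0)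
      = 6 * ∏ v ∈ e, w v := by
  obtain ⟨a, b, c, ab, ac, bc, rfl⟩ := Finset.card_eq_three.1 hc
  have ha : a ∈ V := he (by simp)
  have hb : b ∈ V := he (by simp)
  have hcV : c ∈ V := he (by simp)
  have h1 : ∑ x ∈ V, ∑ y ∈ V, ∑ z ∈ V,
      (if ({x, y, z} : Finset ℕ) = {a, b, c} then w x * w y * w z else 0) =
      ∑ t ∈ V ×ˢ (V ×ˢ V), (if ({t.1, t.2.1, t.2.2} : Finset ℕ) = {a, b, c} then
        w t.1 * w t.2.1 * w t.2.2 else 0) := by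
    rw [Finset.sum_product]
    refine Finset.sum_congr rfl fun x _ => ?_
    rw [Finset.sum_product]
  have h2 : (V ×ˢ (V ×ˢ V)).filter (fun t => ({t.1, t.2.1, t.2.2} : Finset ℕ) = {a, b, c}) =
      {(a, b, c), (a, c, b), (b, a, c), (b, c, a), (c, a, b), (c, b, a)} := by
    ext ⟨x, y, z⟩
    simp only [Finset.mem_filter, Finset.mem_product, Finset.mem_insert, Finset.mem_singleton,
      Prod.mk.injEq]
    constructor
    · rintro ⟨-, h⟩
      have x1 : x ∈ ({a, b, c} : Finset ℕ) := h ▸ (by simp)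
      have y1 : y ∈ ({a, b, c} : Finset ℕ) := h ▸ (by simp)
      have z1 : z ∈ ({a, b, c} : Finset ℕ) := h ▸ (by simp)
      have a1 : a ∈ ({x, y, z} : Finset ℕ) := h ▸ (by simp)
      have b1 : b ∈ ({x, y, z} : Finset ℕ) := h ▸ (by simp)
      have c1 : c ∈ ({x, y, z} : Finset ℕ) := h ▸ (by simp)
      simp only [Finset.mem_insert, Finset.mem_singleton] at x1 y1 z1 a1 b1 c1
      clear h he hc h1
      grind
    · rintro (⟨rfl, rfl, rfl⟩ | ⟨rfl, rfl, rfl⟩ | ⟨rfl, rfl, rfl⟩ | ⟨rfl, rfl, rfl⟩ |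
        ⟨rfl, rfl, rfl⟩ | ⟨rfl, rfl, rfl⟩) <;>
      · refine ⟨⟨by assumption, by assumption, by assumption⟩, ?_⟩
        ext t; simp only [Finset.mem_insert, Finset.mem_singleton]; try tauto
  rw [h1, ← Finset.sum_filter, h2]
  have q : ∏ v ∈ ({a, b, c} : Finset ℕ), w v = w a * w b * w c := by
    rw [Finset.prod_insert (by simp [ab, ac]), Finset.prod_insert (by simp [bc]),
      Finset.prod_singleton, mul_assoc]
  rw [q, Finset.sum_insert, Finset.sum_insert, Finset.sum_insert, Finset.sum_insert,
    Finset.sum_insert, Finset.sum_singleton]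
  · ring
  all_goals
    simp only [Finset.mem_insert, Finset.mem_singleton, Prod.mk.injEq]
    clear h1 h2
    grind

theorem K_of_free (G : ThreeGraph) (hfree : G.Free K43e) {a b c d x y z : ℕ}
    (h1 : ({a, b, c} : Finset ℕ) ∈ G.edges) (h2 : ({a, b, d} : Finset ℕ) ∈ G.edges)
    (h3 : ({a, c, d} : Finset ℕ) ∈ G.edges) (h4 : ({b, c, d} : Finset ℕ) ∈ G.edges)
    (h5 : ({x, y, z} : Finset ℕ) ∈ G.edges) :
    (x = a ∨ x = b ∨ x = c ∨ x = d) ∨ (y = a ∨ y = b ∨ y = c ∨ y = d) ∨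
      (z = a ∨ z = b ∨ z = c ∨ z = d) := by
  by_contra hcon
  push Not at hcon
  obtain ⟨⟨x1, x2, x3, x4⟩, ⟨y1, y2, y3, y4⟩, z1, z2, z3, z4⟩ := hcon
  obtain ⟨ab, ac, bc⟩ := edge_distinct G h1
  obtain ⟨-, ad, bd⟩ := edge_distinct G h2
  obtain ⟨-, -, cd⟩ := edge_distinct G h3
  obtain ⟨xy, xz, yz⟩ := edge_distinct G h5
  refine hfree ⟨fun n => if n = 1 then a else if n = 2 then b else if n = 3 then c else
    if n = 4 then d else if n = 5 then x else if n = 6 then y else z, ?_, ?_, ?_⟩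
  · intro m hm n hn h
    simp only [K43e, Finset.coe_insert, Finset.coe_singleton, Set.mem_insert_iff,
      Set.mem_singleton_iff] at hm hn
    clear h1 h2 h3 h4 h5
    dsimp only at h
    grind (splits := 30)
  · intro v hv
    simp only [K43e, Finset.mem_insert, Finset.mem_singleton] at hv
    have ma := G.edges_sub _ h1 (show a ∈ ({a, b, c} : Finset ℕ) by simp)
    have mb := G.edges_sub _ h1 (show b ∈ ({a, b, c} : Finset ℕ) by simp)
    have mc := G.edges_sub _ h1 (show c ∈ ({a, b, c} : Finset ℕ) by simp)
    have md := G.edges_sub _ h2 (show d ∈ ({a, b, d} : Finset ℕ) by simp)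
    have mx := G.edges_sub _ h5 (show x ∈ ({x, y, z} : Finset ℕ) by simp)
    have my := G.edges_sub _ h5 (show y ∈ ({x, y, z} : Finset ℕ) by simp)
    have mz := G.edges_sub _ h5 (show z ∈ ({x, y, z} : Finset ℕ) by simp)
    rcases hv with rfl | rfl | rfl | rfl | rfl | rfl | rfl <;> simpa
  · intro e he
    simp only [K43e, Finset.mem_insert, Finset.mem_singleton] at he
    rcases he with rfl | rfl | rfl | rfl | rfl <;>
      simpa [Finset.image_insert, Finset.image_singleton]

/-- The local data attached to a graph and a nonnegative weight vector. -/
def toCtx (G : ThreeGraph) (hfree : G.Free K43e) (w : ℕ → ℝ) (h0 : ∀ v, 0 ≤ w v) : Ctx where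
  V := G.verts
  E := fun a b c => ({a, b, c} : Finset ℕ) ∈ G.edges
  w := w
  s1 := fun {a b c} h => by rwa [Finset.insert_comm] at h
  s2 := fun {a b c} h => by rwa [Finset.pair_comm] at h
  ne := fun h => (edge_distinct G h).1
  mem := fun h => G.edges_sub _ h (by simp)
  K := K_of_free G hfree
  nn := h0

theorem T3_lag (G : ThreeGraph) (hfree : G.Free K43e) (w : ℕ → ℝ) (h0 : ∀ v, 0 ≤ w v) :
    (toCtx G hfree w h0).T3 G.verts = 6 * G.lagFun w := by
  unfold HyperGraph.lagFun
  have hr : ∑ e ∈ G.edges, 6 * ∏ v ∈ e, w v = ∑ e ∈ G.edges, ∑ x ∈ G.verts, ∑ y ∈ G.verts,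
      ∑ z ∈ G.verts, (if ({x, y, z} : Finset ℕ) = e then w x * w y * w z else 0) :=
    Finset.sum_congr rfl fun e he =>
      (triple_sum G.verts w (G.edges_sub e he) (G.card_eq e he)).symm
  rw [Finset.mul_sum, hr]
  unfold Ctx.T3
  rw [Finset.sum_comm (s := G.edges)]
  refine Finset.sum_congr rfl fun x _ => ?_
  rw [Finset.sum_comm (s := G.edges)]
  refine Finset.sum_congr rfl fun y _ => ?_
  rw [Finset.sum_comm (s := G.edges)]
  refine Finset.sum_congr rfl fun z _ => ?_
  rw [Finset.sum_ite_eq]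
  by_cases h : ({x, y, z} : Finset ℕ) ∈ G.edges
  · rw [if_pos h, Ctx.psi, Ctx.chi_one _ (show (toCtx G hfree w h0).E x y z from h), one_mul]
    rfl
  · rw [if_neg h, Ctx.psi_zero _ (show ¬ (toCtx G hfree w h0).E x y z from h)]

theorem w_pos (G : ThreeGraph) (hdense : G.LagDense) (w : ℕ → ℝ) (h0 : ∀ v, 0 ≤ w v)
    (h1 : ∑ v ∈ G.verts, w v = 1) (hopt : G.lagFun w = G.lag) :
    ∀ v ∈ G.verts, 0 < w v := by
  intro v hv
  by_contra hneg
  have hz : w v = 0 := le_antisymm (not_lt.1 hneg) (h0 v)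
  let H : ThreeGraph := {
    verts := G.verts.erase v
    edges := G.edges.filter fun e => v ∉ e
    edges_sub := by
      intro e he x hx
      rw [Finset.mem_filter] at he
      rw [Finset.mem_erase]
      exact ⟨fun h => he.2 (h ▸ hx), G.edges_sub e he.1 hx⟩
    card_eq := fun e he => G.card_eq e (Finset.mem_filter.1 he).1 }
  have hlt := hdense H ⟨Finset.erase_subset _ _, Finset.filter_subset _ _⟩
    (Or.inl fun h => by
      have : v ∈ H.verts := h ▸ hv
      exact Finset.notMem_erase v _ this)
  have hsum : ∑ x ∈ H.verts, w x = 1 := by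
    rw [← h1]; exact Finset.sum_erase _ hz
  have hne : H.verts.Nonempty := by
    by_contra hh
    rw [Finset.not_nonempty_iff_eq_empty.1 hh] at hsum
    simp at hsum
  obtain ⟨_, _, _, _, hall⟩ := exists_opt H hne
  have h2 := hall w ⟨fun x _ => h0 x, hsum⟩
  have h3 : H.lagFun w = G.lagFun w := by
    unfold HyperGraph.lagFun
    refine Finset.sum_subset (Finset.filter_subset _ _) fun e he hn => ?_
    have : v ∈ e := by
      by_contra hh
      exact hn (Finset.mem_filter.2 ⟨he, hh⟩)
    exact Finset.prod_eq_zero this hz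
  rw [h3, hopt] at h2
  exact absurd hlt (not_lt.2 h2)

theorem limit_aux {X τ p : ℝ} (hτ : 0 ≤ τ) (h : ∀ δ, 0 < δ → δ ≤ 1 / 2 →
    τ - 3 * δ * X ≤ τ * (1 - δ * p) ^ 3) (hp : 0 ≤ p) : p * τ ≤ X := by
  have h1 : ∀ δ, 0 < δ → δ ≤ 1 / 2 → p * τ ≤ X + δ * (τ * p ^ 2) := by
    intro δ d0 d1
    have h2 := h δ d0 d1
    refine le_of_mul_le_mul_left ?_ (mul_pos three_pos d0)
    have h3 : 0 ≤ τ * (δ * p) ^ 3 := mul_nonneg hτ (pow_nonneg (mul_nonneg d0.le hp) 3)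
    linarith only [h2, h3]
  by_contra hcon
  push Not at hcon
  have hK : 0 ≤ τ * p ^ 2 := mul_nonneg hτ (sq_nonneg p)
  have hm : 0 < τ * p ^ 2 + 1 := by linarith
  have hd : 0 < p * τ - X := by linarith
  have h2 := h1 (min (1 / 2) ((p * τ - X) / (2 * (τ * p ^ 2 + 1)))) (by positivity) (min_le_left _ _)
  have h3 := mul_le_mul_of_nonneg_right (min_le_right (1 / 2) ((p * τ - X) / (2 * (τ * p ^ 2 + 1)))) hK
  have h4 : (p * τ - X) / (2 * (τ * p ^ 2 + 1)) * (τ * p ^ 2) < p * τ - X := by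
    rw [div_mul_eq_mul_div, div_lt_iff₀ (by positivity)]
    nlinarith
  linarith

theorem derivative (G : ThreeGraph) (hfree : G.Free K43e) (w : ℕ → ℝ) (h0 : ∀ v, 0 ≤ w v)
    (h1 : ∑ v ∈ G.verts, w v = 1) (hopt : G.lagFun w = G.lag)
    (hall : ∀ w', G.IsFeasible w' → G.lagFun w' ≤ G.lag) :
    ∀ v ∈ G.verts, w v * (toCtx G hfree w h0).T3 G.verts ≤
      (toCtx G hfree w h0).T2 v G.verts := by
  intro v hv
  set C := toCtx G hfree w h0 with hC
  have hT : C.T3 G.verts = 6 * G.lag := by rw [hC, T3_lag, hopt]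
  have hVi : insert v (G.verts.erase v) = G.verts := Finset.insert_erase hv
  have hni : v ∉ G.verts.erase v := Finset.notMem_erase v _
  have e2 : C.T2 v G.verts = C.T2 v (G.verts.erase v) := by
    conv_lhs => rw [← hVi]
    rw [C.T2_insert v hni]
    have : C.T1 v v (G.verts.erase v) = 0 := Finset.sum_eq_zero fun x _ => C.psi_self _ _
    rw [this]; ring
  have e3 : C.T3 G.verts = 3 * C.T2 v (G.verts.erase v) + C.T3 (G.verts.erase v) := by
    conv_lhs => rw [← hVi]
    exact C.T3_insert hni
  have hnn : 0 ≤ C.T3 G.verts := Finset.sum_nonneg fun x _ => Finset.sum_nonneg fun y _ =>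
    Finset.sum_nonneg fun z _ => C.psi_nonneg _ _ _
  refine limit_aux hnn ?_ (h0 v)
  intro δ d0 d1
  have g0 : ∀ x, 0 ≤ (fun x => if x = v then (1 - δ) * w x else w x) x := by
    intro x; dsimp only; split_ifs
    · exact mul_nonneg (by linarith) (h0 x)
    · exact h0 x
  set w' : ℕ → ℝ := fun x => if x = v then (1 - δ) * w x else w x with hw'
  have wv : w' v = (1 - δ) * w v := by simp [hw']
  have wx : ∀ x ∈ G.verts.erase v, w' x = w x := by
    intro x hx; simp [hw', Finset.ne_of_mem_erase hx]
  have hle : w v ≤ 1 := by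
    rw [← h1]; exact Finset.single_le_sum (fun i _ => h0 i) hv
  have hsum : ∑ x ∈ G.verts, w' x = 1 - δ * w v := by
    rw [← hVi, Finset.sum_insert hni] at h1 ⊢
    rw [Finset.sum_congr rfl wx, wv]; linarith
  have hpos : 0 < 1 - δ * w v := by nlinarith [h0 v]
  have hh := lagFun_hom G hall w' g0 (by rw [hsum]; exact hpos)
  rw [hsum] at hh
  have t3 := T3_lag G hfree w' g0
  set C' := toCtx G hfree w' g0 with hC'
  have f3 : C'.T3 G.verts = 3 * C'.T2 v (G.verts.erase v) + C'.T3 (G.verts.erase v) := by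
    conv_lhs => rw [← hVi]
    exact C'.T3_insert hni
  have r3 : C'.T3 (G.verts.erase v) = C.T3 (G.verts.erase v) := by
    refine Finset.sum_congr rfl fun x hx => Finset.sum_congr rfl fun y hy =>
      Finset.sum_congr rfl fun z hz => ?_
    change C.chi x y z * (w' x * w' y * w' z) = C.chi x y z * (w x * w y * w z)
    rw [wx x hx, wx y hy, wx z hz]
  have r2 : C'.T2 v (G.verts.erase v) = (1 - δ) * C.T2 v (G.verts.erase v) := by
    unfold Ctx.T2
    rw [Finset.mul_sum]
    refine Finset.sum_congr rfl fun y hy => ?_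
    rw [Finset.mul_sum]
    refine Finset.sum_congr rfl fun z hz => ?_
    change C.chi v y z * (w' v * w' y * w' z) = (1 - δ) * (C.chi v y z * (w v * w y * w z))
    rw [wv, wx y hy, wx z hz]; ring
  rw [r3, r2] at f3
  rw [e2, hT]
  linarith only [hh, t3, f3, e3, hT]

theorem main_proof (G : ThreeGraph) (hdense : G.LagDense)
    (hfree : G.Free K43e) (hlag : Real.sqrt 3 / 18 < G.lag) : G.Free Y2 := by
  rintro ⟨f, hinj, hv, hE⟩
  obtain ⟨w, h0, h1, hopt, hall⟩ := exists_opt G ⟨f 1, hv 1 (by decide)⟩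
  have q : ∀ i j k, ({i, j, k} : Finset ℕ) ∈ Y2.edges →
      ({f i, f j, f k} : Finset ℕ) ∈ G.edges := by
    intro i j k h
    have := hE _ h
    simpa only [Finset.image_insert, Finset.image_singleton] using this
  refine (toCtx G hfree w h0).final (a := f 1) (b := f 2) (c := f 3) (d := f 4) (e := f 5) h1
    (q 1 2 3 (by decide)) (q 1 2 4 (by decide)) (q 1 3 4 (by decide)) (q 2 3 4 (by decide))
    (q 1 2 5 (by decide)) (q 1 3 5 (by decide)) (q 2 3 5 (by decide)) ?_
    (w_pos G hdense w h0 h1 hopt) (derivative G hfree w h0 h1 hopt hall) ?_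
  · intro h
    have := hinj (show 4 ∈ (↑Y2.verts : Set ℕ) by decide) (show 5 ∈ (↑Y2.verts : Set ℕ) by decide) h
    omega
  · have := T3_lag G hfree w h0
    change Real.sqrt 3 / 3 < (toCtx G hfree w h0).T3 G.verts
    rw [this, hopt]; linarith only [hlag]


/-- A dense `K_4^3 ∪ e`-free 3-graph with Lagrangian greater than `√3/18` is `Y_2`-free. -/
theorem dense_K43e_free_Y2_free (G : ThreeGraph) (hdense : G.LagDense)
    (hfree : G.Free K43e) (hlag : Real.sqrt 3 / 18 < G.lag) : G.Free Y2 := by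
  exact main_proof G hdense hfree hlag
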